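/- arXiv:2202.11582 — 2 statements merged into one kernel-verified Lean document; each statement's English description precedes it below -/
import Mathlib

section
/- Let n, m ≥ 1, let 1 ≤ k ≤ n, let d ≥ 1, and let f_1, …, f_m ∈ ℂ[x_0, …, x_n] be homogeneous polynomials of degree d. Then there exists a nonzero polynomial H in the k·m entries of a k×m matrix Λ = (λ_{ij}), of total degree at most k·d^{k−1}, such that for every Λ ∈ ℂ^{k×m} with H(Λ) ≠ 0 the following holds: every minimal prime p over the ideal ⟨Σ_{j=1}^m λ_{1j} f_j, …, Σ_{j=1}^m λ_{kj} f_j⟩ of ℂ[x_0, …, x_n] is either a minimal prime over the ideal ⟨f_1, …, f_m⟩ or has height exactly k. -/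
open MvPolynomial

theorem lowest_order {σ A B : Type*} [CommRing A] [CommRing B]
    (θ : MvPolynomial σ A →+* MvPolynomial σ B) (hX : ∀ i, θ (X i) = X i)
    (P : MvPolynomial σ A) (β : σ →₀ ℕ)
    (hmin : ∀ α ∈ P.support, β.degree ≤ α.degree) :
    coeff β (θ P) = constantCoeff (θ (C (coeff β P))) := by
  classical
  have hmon : ∀ α : σ →₀ ℕ, θ (monomial α (1 : A)) = monomial α (1 : B) := by
    intro α
    rw [monomial_eq, monomial_eq]
    simp only [C_1, one_mul, Finsupp.prod, map_prod, map_pow, hX]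
  have key : ∀ α ∈ P.support, α ≠ β → coeff β (θ (monomial α (coeff α P))) = 0 := by
    intro α hα hne
    have : (monomial α (coeff α P) : MvPolynomial σ A) = C (coeff α P) * monomial α 1 := by
      rw [C_mul_monomial, mul_one]
    rw [this, map_mul, hmon, coeff_mul_monomial', if_neg]
    intro hle
    have h1 := hmin α hα
    obtain ⟨γ, rfl⟩ := exists_add_of_le hle
    simp only [map_add] at h1
    have : γ.degree = 0 := by omega
    rw [Finsupp.degree_eq_zero_iff] at this
    subst this
    simp at hne
  conv_lhs => rw [P.as_sum]
  rw [map_sum, coeff_sum]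
  have hβ : coeff β (θ (monomial β (coeff β P))) = constantCoeff (θ (C (coeff β P))) := by
    have : (monomial β (coeff β P) : MvPolynomial σ A) = C (coeff β P) * monomial β 1 := by
      rw [C_mul_monomial, mul_one]
    rw [this, map_mul, hmon, coeff_mul_monomial', if_pos le_rfl]
    simp [constantCoeff_eq]
  by_cases hmem : β ∈ P.support
  · rw [Finset.sum_eq_single β (fun α hα hne => key α hα hne) (fun h => absurd hmem h), hβ]
  · rw [Finset.sum_eq_zero (fun α hα => key α hα (fun h => hmem (h ▸ hα)))]
    rw [notMem_support_iff.mp hmem]; simp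

theorem exists_min_support {σ A : Type*} [CommRing A] (P : MvPolynomial σ A) (hP : P ≠ 0) :
    ∃ β, coeff β P ≠ 0 ∧ ∀ α ∈ P.support, β.degree ≤ α.degree := by
  classical
  have hne : P.support.Nonempty := by
    rwa [Finset.nonempty_iff_ne_empty, Ne, support_eq_empty]
  obtain ⟨β, hβ, h⟩ := P.support.exists_min_image (fun α => α.degree) hne
  exact ⟨β, mem_support_iff.mp hβ, h⟩

theorem generic_inj {F B α ι : Type*} [CommRing F] [CommRing B] [Algebra F B]
    (t : ι → MvPolynomial α B) (a0 : α → F)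
    (h : ∀ Q : MvPolynomial ι F,
      aeval (fun i => eval (fun x => algebraMap F B (a0 x)) (t i)) Q = 0 → Q = 0)
    (Q : MvPolynomial ι (MvPolynomial α F))
    (hQ : eval₂Hom (MvPolynomial.map (algebraMap F B)) t Q = 0) : Q = 0 := by
  -- swap and shift
  let e : MvPolynomial ι (MvPolynomial α F) →+* MvPolynomial α (MvPolynomial ι F) :=
    eval₂Hom (eval₂Hom (C.comp C) (fun x => X x + C (C (a0 x)))) (fun i => C (X i))
  let e' : MvPolynomial α (MvPolynomial ι F) →+* MvPolynomial ι (MvPolynomial α F) :=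
    eval₂Hom (eval₂Hom (C.comp C) (fun i => X i)) (fun x => C (X x - C (a0 x)))
  have hee : ∀ Q, e' (e Q) = Q := by
    intro Q
    have : e'.comp e = RingHom.id _ := by
      ext <;> simp [e, e']
    exact congrArg (fun g => g Q) this
  let sh : MvPolynomial α B →+* MvPolynomial α B :=
    eval₂Hom C (fun x => X x + C (algebraMap F B (a0 x)))
  let θ : MvPolynomial α (MvPolynomial ι F) →+* MvPolynomial α B :=
    eval₂Hom (eval₂Hom (C.comp (algebraMap F B)) (fun i => sh (t i))) X
  have hθ : θ (e Q) = 0 := by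
    have : θ.comp e = sh.comp (eval₂Hom (MvPolynomial.map (algebraMap F B)) t) := by
      ext <;> simp [e, θ, sh]
    have h2 := congrArg (fun g => g Q) this
    simp only [RingHom.comp_apply] at h2
    rw [h2, hQ, map_zero]
  by_contra hne
  have hne' : e Q ≠ 0 := by
    intro h0
    apply hne
    rw [← hee Q, h0, map_zero]
  obtain ⟨β, hβ, hmin⟩ := exists_min_support (e Q) hne'
  have hl := lowest_order θ (by simp [θ]) (e Q) β hmin
  rw [hθ] at hl
  apply hβ
  apply h
  rw [coeff_zero] at hl
  rw [hl]
  have : (constantCoeff.comp θ).comp C = (aeval (fun i => eval (fun x => algebraMap F B (a0 x)) (t i)) : MvPolynomial ι F →ₐ[F] B).toRingHom := by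
    ext i
    · simp [θ]
    · simp only [RingHom.comp_apply, θ, coe_eval₂Hom, eval₂_C, eval₂_X, AlgHom.toRingHom_eq_coe, RingHom.coe_coe, aeval_X]
      have : constantCoeff.comp sh = (eval (fun x => algebraMap F B (a0 x)) : MvPolynomial α B →+* B) := by
        ext <;> simp [sh]
      exact congrArg (fun g => g (t i)) this
  exact (congrArg (fun g => g (coeff β (e Q))) this).symm

noncomputable def cnt (r s : ℕ) : ℕ := Nat.card {α : Fin r →₀ ℕ // α.degree ≤ s}

theorem cnt_finite (r s : ℕ) : Finite {α : Fin r →₀ ℕ // α.degree ≤ s} := by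
  apply Finite.of_injective (β := Fin r → Fin (s+1))
    (fun α i => ⟨α.1 i, by have := Finsupp.le_degree i α.1; have := α.2; omega⟩)
  intro a b h
  ext i
  simpa using congrFun h i

theorem cnt_le (r s : ℕ) : cnt r s ≤ (s + 1) ^ r := by
  have := Nat.card_le_card_of_injective (β := Fin r → Fin (s+1))
    (fun α : {α : Fin r →₀ ℕ // α.degree ≤ s} => fun i => ⟨α.1 i, by have := Finsupp.le_degree i α.1; have := α.2; omega⟩) (by
      intro a b h
      ext i
      simpa using congrFun h i)
  simpa [cnt] using this

theorem cnt_pos (r s : ℕ) : 1 ≤ cnt r s := by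
  have := cnt_finite r s
  have : Nonempty {α : Fin r →₀ ℕ // α.degree ≤ s} := ⟨0, by simp⟩
  exact Nat.card_pos

theorem cnt_mul (r d s e : ℕ) (hd : 1 ≤ d) : cnt r (d * s + e) ≤ d ^ r * cnt r (s + e) := by
  have := cnt_finite r (s + e)
  have h := Nat.card_le_card_of_injective
    (β := (Fin r → Fin d) × {α : Fin r →₀ ℕ // α.degree ≤ s + e})
    (fun α : {α : Fin r →₀ ℕ // α.degree ≤ d * s + e} =>
      (fun i => ⟨α.1 i % d, Nat.mod_lt _ hd⟩,
       ⟨α.1.mapRange (fun x => x / d) (by simp), by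
          have h2 := α.2
          rw [Finsupp.degree_eq_sum] at h2 ⊢
          have : d * ∑ i, α.1 i / d ≤ d * (s + e) := by
            rw [Finset.mul_sum]
            calc _ ≤ ∑ i, α.1 i := Finset.sum_le_sum (fun i _ => Nat.mul_div_le _ _)
              _ ≤ _ := h2.trans (by nlinarith)
          simpa using Nat.le_of_mul_le_mul_left this hd⟩)) (by
      intro a b h
      simp only [Prod.mk.injEq, Subtype.mk.injEq] at h
      ext i
      have h1 := congrFun h.1 i
      have h2 := DFunLike.congr_fun h.2 i
      simp only [Fin.mk.injEq, Finsupp.mapRange_apply] at h1 h2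
      rw [← Nat.div_add_mod (a.1 i) d, ← Nat.div_add_mod (b.1 i) d, h1, h2])
  simpa [cnt] using h

theorem cnt_bound (r d N e : ℕ) (hd : 1 ≤ d)
    (h : ∀ s, N * cnt r s ≤ cnt r (d * s + e)) : N ≤ d ^ r := by
  by_contra hN
  push Not at hN
  have hD : 1 ≤ d ^ r := Nat.one_le_pow _ _ hd
  set D := d ^ r with hDdef
  have h1 : ∀ s, (D + 1) * cnt r s ≤ D * cnt r (s + e) := fun s =>
    (Nat.mul_le_mul_right _ hN).trans ((h s).trans (cnt_mul r d s e hd))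
  have h2 : ∀ t, (D + 1) ^ t ≤ D ^ t * cnt r (t * e) := by
    intro t
    induction t with
    | zero => simpa using cnt_pos r 0
    | succ t ih =>
      calc (D + 1) ^ (t + 1) = (D + 1) * (D + 1) ^ t := by ring
        _ ≤ (D + 1) * (D ^ t * cnt r (t * e)) := Nat.mul_le_mul_left _ ih
        _ = D ^ t * ((D + 1) * cnt r (t * e)) := by ring
        _ ≤ D ^ t * (D * cnt r (t * e + e)) := Nat.mul_le_mul_left _ (h1 _)
        _ = _ := by rw [pow_succ, mul_assoc, add_mul, one_mul]
  have h3 : ∀ t, 1 ≤ t → (D + 1) ^ t ≤ D ^ t * ((e + 1) ^ r * t ^ r) := by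
    intro t ht
    refine (h2 t).trans (Nat.mul_le_mul_left _ ((cnt_le _ _).trans ?_))
    rw [← mul_pow]
    apply Nat.pow_le_pow_left
    nlinarith
  have hDr : (0:ℝ) < D := by exact_mod_cast hD
  have hlim := tendsto_pow_const_div_const_pow_of_one_lt r (r := ((D:ℝ) + 1) / D)
    (by rw [lt_div_iff₀ hDr]; linarith)
  have hpos : (0:ℝ) < 1 / ((e:ℝ) + 1) ^ r := by positivity
  have hev := (hlim.eventually (gt_mem_nhds hpos)).and (Filter.eventually_ge_atTop 1)
  obtain ⟨t, ht, ht1⟩ := hev.exists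
  have h4 : ((D:ℝ) + 1) ^ t ≤ (D:ℝ) ^ t * (((e:ℝ) + 1) ^ r * (t:ℝ) ^ r) := by exact_mod_cast h3 t ht1
  rw [div_pow, div_div_eq_mul_div, div_lt_div_iff₀ (by positivity) (by positivity)] at ht
  linarith

theorem finrank_restrict (r s : ℕ) (L : Type*) [Field L] :
    Module.finrank L (restrictTotalDegree (Fin r) L s) = cnt r s := by
  have h := Module.finrank_eq_nat_card_basis (basisRestrictSupport L {α : Fin r →₀ ℕ | α.sum (fun _ e => e) ≤ s})
  exact h

theorem count_bound {L : Type*} [Field L] (r d N : ℕ) (hd : 1 ≤ d)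
    (u : Fin r → MvPolynomial (Fin r) L) (hu : ∀ i, (u i).totalDegree ≤ d)
    (b : Fin N → MvPolynomial (Fin r) L)
    (hb : ∀ c : Fin N → MvPolynomial (Fin r) L, ∑ j, aeval u (c j) * b j = 0 → ∀ j, c j = 0) :
    N ≤ d ^ r := by
  set e := Finset.univ.sup fun j => (b j).totalDegree with he
  apply cnt_bound r d N e hd
  intro s
  have hau : ∀ c : MvPolynomial (Fin r) L, c.totalDegree ≤ s → (aeval u c).totalDegree ≤ d * s := by
    intro c hc
    rw [aeval_def, eval₂_eq]
    refine totalDegree_finsetSum_le (fun α hα => ?_)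
    refine (totalDegree_mul _ _).trans ?_
    rw [algebraMap_eq, totalDegree_C, zero_add]
    refine (totalDegree_finsetProd _ _).trans ?_
    have h1 : α.degree ≤ s := (le_totalDegree hα).trans hc
    calc ∑ i ∈ α.support, (u i ^ α i).totalDegree ≤ ∑ i ∈ α.support, d * α i := by
          refine Finset.sum_le_sum (fun i _ => (totalDegree_pow _ _).trans ?_)
          rw [mul_comm]; exact Nat.mul_le_mul_right _ (hu i)
      _ = d * α.degree := by rw [Finsupp.degree, ← Finset.mul_sum]; rfl
      _ ≤ d * s := Nat.mul_le_mul_left _ h1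
  let T0 : (Fin N → restrictTotalDegree (Fin r) L s) →ₗ[L] MvPolynomial (Fin r) L :=
    { toFun := fun c => ∑ j, aeval u (c j : MvPolynomial (Fin r) L) * b j
      map_add' := by intro x y; simp [add_mul, Finset.sum_add_distrib]
      map_smul' := by intro x y; simp [Finset.smul_sum] }
  let T : (Fin N → restrictTotalDegree (Fin r) L s) →ₗ[L] restrictTotalDegree (Fin r) L (d * s + e) :=
    T0.codRestrict _ (by
      intro c
      rw [mem_restrictTotalDegree]
      refine totalDegree_finsetSum_le (fun j _ => (totalDegree_mul _ _).trans ?_)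
      refine add_le_add (hau _ ?_) ?_
      · exact (mem_restrictTotalDegree _ _ _).mp (c j).2
      · exact Finset.le_sup (f := fun j => (b j).totalDegree) (Finset.mem_univ j))
  have hT : Function.Injective T := by
    rw [injective_iff_map_eq_zero]
    intro c hc
    have := hb (fun j => c j) (congrArg Subtype.val hc)
    ext j : 2
    simpa using this j
  have := LinearMap.finrank_le_finrank_of_injective hT
  rw [Module.finrank_pi_fintype] at this
  simpa [finrank_restrict] using this

theorem norm_poly {K E J : Type*} [Field K] [Field E] [Algebra K E] [FiniteDimensional K E]
    [Fintype J] [DecidableEq J] (f : J → E) (j0 : J) (hj0 : f j0 = 1) :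
    ∃ G : MvPolynomial J K, G ≠ 0 ∧ G.totalDegree ≤ Module.finrank K E ∧
      ∀ (Ω : Type _) [CommRing Ω] [IsDomain Ω] (j : E →+* Ω) (y : J → Ω),
        ∑ a, y a * j (f a) = 0 → eval₂Hom (j.comp (algebraMap K E)) y G = 0 := by
  classical
  let b := Module.finBasis K E
  let n := Module.finrank K E
  let M : J → Matrix (Fin n) (Fin n) K := fun a => Algebra.leftMulMatrix b (f a)
  let P : Matrix (Fin n) (Fin n) (MvPolynomial J K) :=
    Matrix.of fun i l => ∑ a, C (M a i l) * X a
  refine ⟨P.det, ?_, ?_, ?_⟩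
  · intro h0
    have h1 := congrArg (eval (Pi.single j0 (1 : K))) h0
    rw [RingHom.map_det, map_zero] at h1
    have : (eval (Pi.single j0 (1 : K))).mapMatrix P = 1 := by
      have h2 : M j0 = 1 := by simp [M, hj0]
      rw [← h2]
      ext i l
      simp [P, Pi.single_apply]
    rw [this, Matrix.det_one] at h1
    exact one_ne_zero h1
  · rw [Matrix.det_apply]
    refine totalDegree_finsetSum_le (fun σ _ => ?_)
    have hs : (Equiv.Perm.sign σ • ∏ i, P (σ i) i).totalDegree ≤ (∏ i, P (σ i) i).totalDegree := by
      rcases Int.units_eq_one_or (Equiv.Perm.sign σ) with h | h <;> rw [h] <;> simp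
    refine hs.trans ((totalDegree_finsetProd _ _).trans ?_)
    calc ∑ i, (P (σ i) i).totalDegree ≤ ∑ i : Fin n, 1 := by
          refine Finset.sum_le_sum (fun i _ => totalDegree_finsetSum_le (fun a _ => ?_))
          refine (totalDegree_mul _ _).trans ?_
          rw [totalDegree_C, totalDegree_X]
      _ = n := by simp
  · intro Ω _ _ j y hy
    rw [RingHom.map_det]
    rw [← Matrix.exists_vecMul_eq_zero_iff]
    refine ⟨fun i => j (b i), ?_, ?_⟩
    · intro h0
      have hn : 0 < n := Module.finrank_pos
      have := congrFun h0 ⟨0, hn⟩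
      simp only [Pi.zero_apply, map_eq_zero] at this
      exact b.ne_zero _ this
    · ext l
      have hM : ∀ a, ∑ i, b i * algebraMap K E (M a i l) = f a * b l := by
        intro a
        rw [← b.sum_repr (f a * b l)]
        refine Finset.sum_congr rfl (fun i _ => ?_)
        simp only [M, Algebra.leftMulMatrix_eq_repr_mul]
        rw [Algebra.smul_def, mul_comm]
      have hP : ∀ i, eval₂Hom (j.comp (algebraMap K E)) y (P i l)
          = ∑ a, j (algebraMap K E (M a i l)) * y a := by
        intro i
        simp [P]
      change ∑ i, j (b i) * eval₂Hom (j.comp (algebraMap K E)) y (P i l) = 0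
      simp only [hP, Finset.mul_sum]
      rw [Finset.sum_comm]
      calc _ = ∑ a, y a * j (∑ i, b i * algebraMap K E (M a i l)) := by
            refine Finset.sum_congr rfl (fun a _ => ?_)
            rw [map_sum, Finset.mul_sum]
            refine Finset.sum_congr rfl (fun i _ => ?_)
            simp; ring
        _ = (∑ a, y a * j (f a)) * j (b l) := by
            rw [Finset.sum_mul]
            refine Finset.sum_congr rfl (fun a _ => ?_)
            rw [hM, map_mul]; ring
        _ = 0 := by rw [hy, zero_mul]

/-- clearing denominators -/
theorem clear_denom {R K J : Type*} [CommRing R] [IsDomain R] [Field K] [Algebra R K] [IsFractionRing R K]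
    (G : MvPolynomial J K) (hG : G ≠ 0) :
    ∃ G' : MvPolynomial J R, G' ≠ 0 ∧ G'.totalDegree ≤ G.totalDegree ∧
      ∃ c : K, MvPolynomial.map (algebraMap R K) G' = C c * G := by
  classical
  obtain ⟨c, hc⟩ := IsLocalization.exist_integer_multiples (nonZeroDivisors R) G.support (fun α => coeff α G)
  choose! g hg using hc
  have hinj := IsFractionRing.injective R K
  have hmap : MvPolynomial.map (algebraMap R K) (∑ α ∈ G.support, monomial α (g α)) = C (algebraMap R K c) * G := by
    conv_rhs => rw [G.as_sum]
    rw [map_sum, Finset.mul_sum]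
    refine Finset.sum_congr rfl (fun α hα => ?_)
    rw [map_monomial, hg α hα, C_mul_monomial, Algebra.smul_def]
  refine ⟨∑ α ∈ G.support, monomial α (g α), ?_, ?_, algebraMap R K c, hmap⟩
  · intro h0
    rw [h0, map_zero] at hmap
    have : C (σ := J) (algebraMap R K c) ≠ 0 := by
      rw [Ne, C_eq_zero]
      exact IsLocalization.to_map_ne_zero_of_mem_nonZeroDivisors _ le_rfl c.2
    exact (mul_ne_zero this hG) hmap.symm
  · refine totalDegree_finsetSum_le (fun α hα => ?_)
    exact (totalDegree_monomial_le _ _).trans (le_totalDegree hα)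

theorem gcd_poly {R : Type*} [CommRing R] [IsDomain R] [UniqueFactorizationMonoid R]
    (I : Ideal (Polynomial R)) [I.IsPrime] (hI : ∀ a : R, Polynomial.C a ∈ I → a = 0)
    (D0 : Polynomial R) (hD0 : D0 ∈ I) (h0 : D0 ≠ 0) :
    ∃ H ∈ I, H ≠ 0 ∧ ∀ D ∈ I, H ∣ D := by
  classical
  let _ : NormalizedGCDMonoid R := Classical.choice inferInstance
  obtain ⟨H, hHirr, hHI⟩ : ∃ H, Irreducible H ∧ H ∈ I := by
    obtain ⟨s, hs, hs2⟩ := WfDvdMonoid.exists_factors D0 h0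
    have : s.prod ∈ I := by
      obtain ⟨v, hv⟩ := hs2
      rw [← hv] at hD0
      rcases (‹I.IsPrime›).mem_or_mem hD0 with h | h
      · exact h
      · exact absurd (I.eq_top_of_isUnit_mem h v.isUnit) (Ideal.IsPrime.ne_top ‹_›)
    obtain ⟨a, ha, haI⟩ := ((‹I.IsPrime›).multiset_prod_mem_iff_exists_mem s).mp this
    exact ⟨a, hs a ha, haI⟩
  refine ⟨H, hHI, hHirr.ne_zero, fun D hD => ?_⟩
  have hdeg : H.natDegree ≠ 0 := by
    intro h
    rw [Polynomial.natDegree_eq_zero] at h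
    obtain ⟨a, rfl⟩ := h
    have := hI a hHI
    rw [this, map_zero] at hHirr
    exact hHirr.ne_zero rfl
  have hprim : H.IsPrimitive := hHirr.isPrimitive hdeg
  by_cases hDz : D = 0
  · rw [hDz]; exact dvd_zero _
  have hDp : D.primPart ∈ I := by
    rw [D.eq_C_content_mul_primPart] at hD
    rcases (‹I.IsPrime›).mem_or_mem hD with h | h
    · exact absurd (Polynomial.content_eq_zero_iff.mp (hI _ h)) hDz
    · exact h
  refine dvd_trans ?_ D.primPart_dvd
  by_contra hdvd
  let K := FractionRing R
  have hirrK : Irreducible (H.map (algebraMap R K)) :=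
    (hprim.irreducible_iff_irreducible_map_fraction_map).mp hHirr
  have hcop : IsCoprime (H.map (algebraMap R K)) (D.primPart.map (algebraMap R K)) := by
    rw [hirrK.coprime_iff_not_dvd]
    intro h
    exact hdvd (hprim.dvd_of_fraction_map_dvd_fraction_map h)
  obtain ⟨a, b, hab⟩ := hcop
  obtain ⟨c1, hc1, h1⟩ := IsLocalization.integerNormalization_spec (nonZeroDivisors R) a
  obtain ⟨c2, hc2, h2⟩ := IsLocalization.integerNormalization_spec (nonZeroDivisors R) b
  set a' := IsLocalization.integerNormalization (nonZeroDivisors R) a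
  set b' := IsLocalization.integerNormalization (nonZeroDivisors R) b
  have hfin : Polynomial.C (c2 : R) * a' * H + Polynomial.C (c1 : R) * b' * D.primPart
      = Polynomial.C ((c1 : R) * c2) := by
    apply Polynomial.map_injective _ (IsFractionRing.injective R K)
    simp only [Polynomial.map_add, Polynomial.map_mul, h1, h2, Polynomial.map_C, map_mul]
    have e1 : ∀ (c : R) (p : Polynomial K), c • p = Polynomial.C (algebraMap R K c) * p := by
      intro c p
      rw [← algebraMap_smul K, Polynomial.smul_eq_C_mul]
    rw [e1, e1]
    linear_combination (Polynomial.C (algebraMap R K c1) * Polynomial.C (algebraMap R K c2)) * hab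
  have := hI ((c1 : R) * c2) (by
    rw [← hfin]
    exact I.add_mem (I.mul_mem_left _ hHI) (I.mul_mem_left _ hDp))
  exact (mul_ne_zero (nonZeroDivisors.ne_zero hc1) (nonZeroDivisors.ne_zero hc2)) this

theorem gcd_mvpoly {σ F : Type*} [Field F] (a : σ) (I : Ideal (MvPolynomial σ F)) [I.IsPrime]
    (hI : ∀ P : MvPolynomial {x // x ≠ a} F, rename Subtype.val P ∈ I → P = 0)
    (D0 : MvPolynomial σ F) (hD0 : D0 ∈ I) (h0 : D0 ≠ 0) :
    ∃ H ∈ I, H ≠ 0 ∧ ∀ D ∈ I, H ∣ D := by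
  classical
  let e : MvPolynomial σ F ≃ₐ[F] Polynomial (MvPolynomial {x // x ≠ a} F) :=
    (renameEquiv F (Equiv.optionSubtypeNe a).symm).trans (optionEquivLeft F {x // x ≠ a})
  have hp : (I.comap e.symm.toRingEquiv.toRingHom).IsPrime := Ideal.IsPrime.comap _
  obtain ⟨H, hH, hne, hdvd⟩ := gcd_poly (I.comap e.symm.toRingEquiv.toRingHom) (by
    intro P hP
    apply hI
    have : e (rename Subtype.val P) = Polynomial.C P := by
      have : e.toAlgHom.comp (rename (Subtype.val : {x // x ≠ a} → σ))
          = (Polynomial.CAlgHom : _ →ₐ[MvPolynomial {x // x ≠ a} F] _).restrictScalars F := by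
        ext x : 1
        simp [e, optionEquivLeft_X_some, x.2]
      exact congrArg (fun g => g P) this
    rw [← e.symm_apply_apply (rename Subtype.val P), this]
    exact hP) (e D0) (by
      change e.symm (e D0) ∈ I
      simpa using hD0) (by simpa using h0)
  refine ⟨e.symm H, hH, by simpa using hne, fun D hD => ?_⟩
  have := hdvd (e D) (by
      change e.symm (e D) ∈ I
      simpa using hD)
  simpa using map_dvd e.symm this

theorem findim {A L K E : Type*} (r d : ℕ) (hd : 1 ≤ d) [CommRing A] [IsDomain A] [Field L] [Algebra A L]
    [IsFractionRing A L] [Field K] [Algebra (MvPolynomial (Fin r) A) K]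
    [IsFractionRing (MvPolynomial (Fin r) A) K] [Field E] [Algebra (MvPolynomial (Fin r) L) E]
    [IsFractionRing (MvPolynomial (Fin r) L) E] [Algebra K E]
    (u : Fin r → MvPolynomial (Fin r) L) (hu : ∀ i, (u i).totalDegree ≤ d)
    (hc : ∀ P : MvPolynomial (Fin r) A, algebraMap K E (algebraMap _ K P)
      = algebraMap _ E (aeval u (MvPolynomial.map (algebraMap A L) P))) :
    FiniteDimensional K E ∧ Module.finrank K E ≤ d ^ r := by
  classical
  have hrank : Module.rank K E ≤ (d ^ r : ℕ) := by
    apply rank_le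
    intro s hs
    obtain ⟨q, hq⟩ := IsLocalization.exist_integer_multiples_of_finset
      (nonZeroDivisors (MvPolynomial (Fin r) L)) s
    let e := s.equivFin.symm
    choose b hb using fun j : Fin s.card => hq (e j) (e j).2
    refine count_bound r d s.card hd u hu b (fun c hcs => ?_)
    let _ : Algebra (MvPolynomial (Fin r) A) (MvPolynomial (Fin r) L) := algebraMvPolynomial
    obtain ⟨⟨a, ha⟩, hac⟩ := IsLocalization.exist_integer_multiples_of_finite
      ((nonZeroDivisors A).map (C (σ := Fin r))) c
    choose c' hc' using hac
    obtain ⟨a0, ha0, rfl⟩ := ha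
    have hc'' : ∀ j, MvPolynomial.map (algebraMap A L) (c' j) = C (algebraMap A L a0) * c j := by
      intro j
      have := hc' j
      rw [Algebra.smul_def, algebraMap_def] at this
      simpa using this
    have hane : algebraMap A L a0 ≠ 0 :=
      IsLocalization.to_map_ne_zero_of_mem_nonZeroDivisors _ le_rfl ha0
    have hqne : algebraMap (MvPolynomial (Fin r) L) E q ≠ 0 :=
      IsLocalization.to_map_ne_zero_of_mem_nonZeroDivisors _ le_rfl q.2
    have hzero : ∑ j, (algebraMap _ K (c' j)) • (e j : E) = 0 := by
      have h1 : ∑ j, aeval u (MvPolynomial.map (algebraMap A L) (c' j)) * b j = 0 := by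
        calc _ = C (algebraMap A L a0) * ∑ j, aeval u (c j) * b j := by
              rw [Finset.mul_sum]
              refine Finset.sum_congr rfl (fun j _ => ?_)
              rw [hc'', map_mul, aeval_C, mul_assoc]; rfl
          _ = 0 := by rw [hcs, mul_zero]
      have h2 := congrArg (algebraMap (MvPolynomial (Fin r) L) E) h1
      rw [map_sum, map_zero] at h2
      have h3 : ∀ j, algebraMap (MvPolynomial (Fin r) L) E
          (aeval u (MvPolynomial.map (algebraMap A L) (c' j)) * b j)
          = algebraMap (MvPolynomial (Fin r) L) E q * ((algebraMap _ K (c' j)) • (e j : E)) := by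
        intro j
        rw [map_mul, ← hc, hb, Algebra.smul_def, Algebra.smul_def]; ring
      simp only [h3] at h2
      rw [← Finset.mul_sum] at h2
      exact (mul_eq_zero.mp h2).resolve_left hqne
    have hli : LinearIndependent K (fun j => (e j : E)) := hs.comp e e.injective
    intro j
    have h4 := Fintype.linearIndependent_iff.mp hli _ hzero j
    have h5 : c' j = 0 := (IsFractionRing.injective (MvPolynomial (Fin r) A) K) (by rw [h4, map_zero])
    have h6 := hc'' j
    rw [h5, map_zero] at h6
    exact (mul_eq_zero.mp h6.symm).resolve_left (fun h => hane (C_eq_zero.mp h))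
  have hfin : FiniteDimensional K E := by
    rw [FiniteDimensional, ← Module.rank_lt_aleph0_iff]
    exact hrank.trans_lt (Cardinal.natCast_lt_aleph0)
  refine ⟨hfin, ?_⟩
  rw [← Module.finrank_eq_rank] at hrank
  exact_mod_cast hrank

theorem totalDegree_map_le' {R S σ : Type*} [CommSemiring R] [CommSemiring S] (f : R →+* S)
    (p : MvPolynomial σ R) : (MvPolynomial.map f p).totalDegree ≤ p.totalDegree :=
  Finset.sup_mono (support_map_subset f p)

theorem norm_row_abs {A L K E J' : Type} (r d : ℕ) (hd : 1 ≤ d) [CommRing A] [IsDomain A] [Field L]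
    [Algebra A L]
    [IsFractionRing A L] [Field K] [Algebra (MvPolynomial (Fin r) A) K]
    [IsFractionRing (MvPolynomial (Fin r) A) K] [Field E] [Algebra (MvPolynomial (Fin r) L) E]
    [IsFractionRing (MvPolynomial (Fin r) L) E] [Fintype J']
    (g : J' → MvPolynomial (Fin r) A) (u : Fin r → MvPolynomial (Fin r) A)
    (hud : ∀ i, (u i).totalDegree ≤ d)
    (hw : Function.Injective (eval₂Hom C u : MvPolynomial (Fin r) A →+* MvPolynomial (Fin r) A)) :
    ∃ G : MvPolynomial (Option J') (MvPolynomial (Fin r) A), G ≠ 0 ∧ G.totalDegree ≤ d ^ r ∧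
      eval₂Hom (C.comp (eval₂Hom C u : MvPolynomial (Fin r) A →+* MvPolynomial (Fin r) A))
        (fun o => Option.elim o (- ∑ j, X j * C (g j)) X :
          Option J' → MvPolynomial J' (MvPolynomial (Fin r) A)) G = 0 := by
  classical
  have hAL : Function.Injective (MvPolynomial.map (algebraMap A L) : MvPolynomial (Fin r) A →+* _) :=
    map_injective _ (IsFractionRing.injective A L)
  obtain ⟨w2, hw2d⟩ : ∃ w2 : MvPolynomial (Fin r) A →+* E,
    w2 = (algebraMap (MvPolynomial (Fin r) L) E).comp ((MvPolynomial.map (algebraMap A L))) := ⟨_, rfl⟩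
  have hw2 : Function.Injective w2 := by
    rw [hw2d, RingHom.coe_comp]
    exact (IsFractionRing.injective _ E).comp hAL
  have hw3 : Function.Injective (w2.comp (eval₂Hom C u)) := by
    rw [RingHom.coe_comp]
    exact hw2.comp hw
  let _ : Algebra K E := (IsFractionRing.lift hw3 : K →+* E).toAlgebra
  have hKE : ∀ P : MvPolynomial (Fin r) A, algebraMap K E (algebraMap _ K P) = w2 (eval₂Hom C u P) := by
    intro P
    exact IsFractionRing.lift_algebraMap hw3 P
  obtain ⟨hfin, hrk⟩ := findim (A := A) (L := L) (K := K) (E := E) r d hd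
    (fun i => MvPolynomial.map (algebraMap A L) (u i))
    (fun i => (totalDegree_map_le' _ _).trans (hud i)) (by
    intro P
    rw [hKE, hw2d, RingHom.comp_apply]
    congr 1
    rw [coe_eval₂Hom, map_eval₂, aeval_def, eval₂_map, algebraMap_eq, eval₂_map]
    rfl)
  obtain ⟨G, hG0, hGd, hG⟩ := norm_poly (K := K) (E := E) (J := Option J')
    (fun o => Option.elim o 1 (fun j => w2 (g j))) none rfl
  obtain ⟨G', hG'0, hG'd, c, hGG⟩ := clear_denom (R := MvPolynomial (Fin r) A) (K := K) G hG0
  refine ⟨G', hG'0, hG'd.trans (hGd.trans hrk), ?_⟩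
  apply map_injective w2 hw2
  have h1 := hG (MvPolynomial J' E) C
    (fun o => Option.elim o (- ∑ j, X j * C (w2 (g j))) X) (by
      rw [Fintype.sum_option]
      simp)
  have h2 : eval₂Hom (C.comp (algebraMap K E)) (fun o => Option.elim o (- ∑ j, X j * C (w2 (g j))) X)
      (MvPolynomial.map (algebraMap (MvPolynomial (Fin r) A) K) G') = 0 := by
    rw [hGG, map_mul, h1, mul_zero]
  rw [map_zero, ← h2]
  simp only [coe_eval₂Hom]
  rw [eval₂_map]
  have h3 := RingHom.congr_fun (comp_eval₂Hom (C.comp (eval₂Hom C u)) (fun o => Option.elim o (- ∑ j, X j * C (g j)) X :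
          Option J' → MvPolynomial J' (MvPolynomial (Fin r) A)) (MvPolynomial.map w2)) G'
  refine h3.trans ?_
  simp only [coe_eval₂Hom]
  congr 1
  · refine RingHom.ext fun P => ?_
    simp [hKE]
  · funext o
    cases o <;> simp

section
variable {F : Type} [Field F] {r : ℕ} {κ : Type} [Fintype κ]

theorem u_indep {ρ : Type} (e : Fin r → ρ) (he : Function.Injective e)
    (g : Fin r ⊕ κ → MvPolynomial (Fin r) F) (hg : ∀ l, g (Sum.inl l) = X l)
    (Q : MvPolynomial (Fin r) (MvPolynomial (ρ × (Fin r ⊕ κ)) F))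
    (hQ : eval₂Hom (MvPolynomial.map (C : F →+* MvPolynomial (Fin r) F))
      (fun i => - ∑ j, X (e i, j) * C (g j)) Q = 0) : Q = 0 := by
  classical
  refine generic_inj (F := F) (B := MvPolynomial (Fin r) F) _
    (fun x => Sum.elim (fun l => if x.1 = e l then -1 else 0) (fun _ => 0) x.2) ?_ Q hQ
  intro Q hQ
  have : (fun i : Fin r => eval (fun x : ρ × (Fin r ⊕ κ) => algebraMap F (MvPolynomial (Fin r) F)
      (Sum.elim (fun l => if x.1 = e l then -1 else 0) (fun _ => 0) x.2))
      (-∑ j, X (e i, j) * C (g j))) = X := by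
    funext i
    simp [he.eq_iff, hg, ite_mul, apply_ite]
  rw [this] at hQ
  simpa using hQ

theorem norm_row (d : ℕ) (hd : 1 ≤ d)
    (g : Fin r ⊕ κ → MvPolynomial (Fin r) F) (hg : ∀ l, g (Sum.inl l) = X l)
    (hgd : ∀ j, (g j).totalDegree ≤ d) :
    ∃ G : MvPolynomial (Option (Fin r ⊕ κ)) (MvPolynomial (Fin r) (MvPolynomial (Fin r × (Fin r ⊕ κ)) F)),
      G ≠ 0 ∧ G.totalDegree ≤ d ^ r ∧
      eval₂Hom (C.comp (eval₂Hom C (fun i => - ∑ j, C (X (i, j)) * MvPolynomial.map C (g j)) :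
          MvPolynomial (Fin r) (MvPolynomial (Fin r × (Fin r ⊕ κ)) F) →+*
          MvPolynomial (Fin r) (MvPolynomial (Fin r × (Fin r ⊕ κ)) F)))
        (fun o => Option.elim o (- ∑ j, X j * C (MvPolynomial.map C (g j))) X :
          Option (Fin r ⊕ κ) → MvPolynomial (Fin r ⊕ κ)
            (MvPolynomial (Fin r) (MvPolynomial (Fin r × (Fin r ⊕ κ)) F))) G = 0 := by
  classical
  refine norm_row_abs (L := FractionRing (MvPolynomial (Fin r × (Fin r ⊕ κ)) F))
    (K := FractionRing (MvPolynomial (Fin r) (MvPolynomial (Fin r × (Fin r ⊕ κ)) F)))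
    (E := FractionRing (MvPolynomial (Fin r) (FractionRing (MvPolynomial (Fin r × (Fin r ⊕ κ)) F))))
    r d hd (fun j => MvPolynomial.map C (g j)) _ ?_ ?_
  · intro i
    rw [totalDegree_neg]
    refine totalDegree_finsetSum_le (fun j _ => (totalDegree_mul _ _).trans ?_)
    rw [totalDegree_C, zero_add]
    exact (totalDegree_map_le' _ _).trans (hgd j)
  · rw [injective_iff_map_eq_zero]
    intro Q hQ
    refine u_indep id Function.injective_id g hg Q ?_
    obtain ⟨sw, hswd⟩ : ∃ sw : MvPolynomial (Fin r) (MvPolynomial (Fin r × (Fin r ⊕ κ)) F) →+* MvPolynomial (Fin r × (Fin r ⊕ κ)) (MvPolynomial (Fin r) F), sw =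
      eval₂Hom (MvPolynomial.map C) (fun i => C (X i)) := ⟨_, rfl⟩
    have hsw : ∀ p : MvPolynomial (Fin r) F, sw (MvPolynomial.map C p) = C p := by
      intro p
      have : sw.comp (MvPolynomial.map C) = C := by
        apply ringHom_ext
        · intro a
          simp [hswd]
        · intro a
          simp [hswd]
      exact congrArg (fun g => g p) this
    rw [← map_zero sw, ← hQ, ← RingHom.comp_apply, comp_eval₂Hom]
    congr 2
    · apply ringHom_ext <;> simp [hswd]
    · funext i
      simp only [map_neg, map_sum, map_mul, hsw]
      simp [hswd]
end

noncomputable def scale {σ F : Type*} [CommRing F] (w : σ → ℕ) :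
    MvPolynomial σ F →+* Polynomial (MvPolynomial σ F) :=
  eval₂Hom (Polynomial.C.comp C) (fun x => Polynomial.C (X x) * Polynomial.X ^ (w x))

theorem scale_monomial {σ F : Type*} [CommRing F] (w : σ → ℕ) (β : σ →₀ ℕ) (c : F) :
    scale w (monomial β c) = Polynomial.C (monomial β c) * Polynomial.X ^ (Finsupp.weight w β) := by
  rw [scale, coe_eval₂Hom, eval₂_monomial, monomial_eq, map_mul, mul_assoc, Finsupp.weight_apply,
    Finsupp.sum, Finsupp.prod, Finsupp.prod, map_prod, ← Finset.prod_pow_eq_pow_sum,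
    ← Finset.prod_mul_distrib]
  congr 1
  refine Finset.prod_congr rfl fun x _ => ?_
  rw [mul_pow, map_pow, ← pow_mul, smul_eq_mul, mul_comm (w x)]

theorem coeff_scale {σ F : Type*} [CommRing F] (w : σ → ℕ) (H : MvPolynomial σ F) (β : σ →₀ ℕ) :
    coeff β ((scale w H).coeff (Finsupp.weight w β)) = coeff β H := by
  classical
  induction H using MvPolynomial.induction_on' with
  | monomial u a =>
    rw [scale_monomial, Polynomial.coeff_C_mul_X_pow]
    split_ifs with h
    · rfl
    · rw [coeff_zero, coeff_monomial, if_neg]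
      rintro rfl
      exact h rfl
  | add p q hp hq => simp [hp, hq]

theorem scale_ne_zero {σ F : Type*} [CommRing F] (w : σ → ℕ) (H : MvPolynomial σ F) (h : H ≠ 0) :
    scale w H ≠ 0 := by
  intro h0
  apply h
  ext β
  rw [← coeff_scale w, h0]; simp

theorem natDegree_eval₂_le {J R S : Type*} [CommRing R] [CommRing S] (φ : R →+* Polynomial S)
    (y : J → Polynomial S) (hφ : ∀ a, (φ a).natDegree = 0) (hy : ∀ o, (y o).natDegree ≤ 1)
    (G : MvPolynomial J R) : (eval₂Hom φ y G).natDegree ≤ G.totalDegree := by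
  rw [coe_eval₂Hom, eval₂_eq]
  refine Polynomial.natDegree_sum_le_of_forall_le _ _ fun β hβ => ?_
  refine Polynomial.natDegree_mul_le.trans ?_
  rw [hφ, zero_add]
  refine (Polynomial.natDegree_prod_le _ _).trans ?_
  refine le_trans ?_ (le_totalDegree hβ)
  refine Finset.sum_le_sum fun o _ => ?_
  refine Polynomial.natDegree_pow_le.trans ?_
  calc _ ≤ β o * 1 := Nat.mul_le_mul_left _ (hy o)
    _ = _ := mul_one _

theorem totalDegree_le_rows {ι J F : Type*} [Fintype ι] [DecidableEq ι] [CommRing F]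
    (H : MvPolynomial (ι × J) F) (N : ℕ)
    (h : ∀ i, (scale (fun x : ι × J => if x.1 = i then 1 else 0) H).natDegree ≤ N) :
    H.totalDegree ≤ Fintype.card ι * N := by
  rw [totalDegree]
  refine Finset.sup_le fun β hβ => ?_
  have h1 : ∀ i, Finsupp.weight (fun x : ι × J => if x.1 = i then 1 else 0) β ≤ N := by
    intro i
    refine le_trans (Polynomial.le_natDegree_of_ne_zero fun h0 => ?_) (h i)
    have := coeff_scale (fun x : ι × J => if x.1 = i then 1 else 0) H β
    rw [h0, coeff_zero] at this
    exact (mem_support_iff.mp hβ) this.symm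
  calc (β.sum fun _ e => e) = ∑ i, Finsupp.weight (fun x : ι × J => if x.1 = i then 1 else 0) β := by
        simp only [Finsupp.weight_apply, Finsupp.sum]
        rw [Finset.sum_comm]
        refine Finset.sum_congr rfl fun x _ => ?_
        simp
    _ ≤ ∑ i : ι, N := Finset.sum_le_sum fun i _ => h1 i
    _ = _ := by simp

section
variable {F : Type} [Field F] {r : ℕ} {κ : Type} [Fintype κ]

noncomputable def psi (g : Fin r ⊕ κ → MvPolynomial (Fin r) F) :
    MvPolynomial (Fin (r+1) × Option (Fin r ⊕ κ)) F →+*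
      MvPolynomial (Fin (r+1) × (Fin r ⊕ κ)) (MvPolynomial (Fin r) F) :=
  eval₂Hom (C.comp C) (fun x => x.2.elim (-∑ j, X (x.1, j) * C (g j)) (fun j => X (x.1, j)))

theorem psi_indep (g : Fin r ⊕ κ → MvPolynomial (Fin r) F) (hg : ∀ l, g (Sum.inl l) = X l)
    (P : MvPolynomial {x : Fin (r+1) × Option (Fin r ⊕ κ) // x ≠ (0, none)} F)
    (hP : psi g (rename Subtype.val P) = 0) : P = 0 := by
  obtain ⟨ζ, hζ⟩ : ∃ ζ : MvPolynomial {x : Fin (r+1) × Option (Fin r ⊕ κ) // x ≠ (0, none)} F →+*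
      MvPolynomial (Fin r) (MvPolynomial (Fin (r+1) × (Fin r ⊕ κ)) F),
      ζ = eval₂Hom (C.comp C) (fun x => x.1.2.elim (Fin.cases 0 X x.1.1) (fun j => C (X (x.1.1, j)))) :=
    ⟨_, rfl⟩
  obtain ⟨η, hη⟩ : ∃ η : MvPolynomial (Fin r) (MvPolynomial (Fin (r+1) × (Fin r ⊕ κ)) F) →+*
      MvPolynomial {x : Fin (r+1) × Option (Fin r ⊕ κ) // x ≠ (0, none)} F,
      η = eval₂Hom (eval₂Hom C (fun x => X ⟨(x.1, some x.2), by simp⟩))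
        (fun i => X ⟨(i.succ, none), by simp⟩) := ⟨_, rfl⟩
  have h1 : ∀ P, η (ζ P) = P := by
    intro P
    have : η.comp ζ = RingHom.id _ := by
      apply ringHom_ext
      · intro a; simp [hη, hζ]
      · rintro ⟨⟨i, o⟩, h⟩
        cases o with
        | some j => simp [hη, hζ]
        | none =>
          cases i using Fin.cases with
          | zero => exact absurd rfl h
          | succ i => simp [hη, hζ]
    exact congrArg (fun g => g P) this
  have h2 : (eval₂Hom (MvPolynomial.map (C : F →+* MvPolynomial (Fin r) F))
      (fun i => - ∑ j, X (Fin.succ i, j) * C (g j))) (ζ P) = psi g (rename Subtype.val P) := by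
    have : (eval₂Hom (MvPolynomial.map (C : F →+* MvPolynomial (Fin r) F))
      (fun i => - ∑ j, X (Fin.succ i, j) * C (g j))).comp ζ =
       (psi g).comp (rename Subtype.val : _ →ₐ[F] _).toRingHom := by
      apply ringHom_ext
      · intro a; simp [psi, hζ]
      · rintro ⟨⟨i, o⟩, h⟩
        cases o with
        | some j => simp [psi, hζ]
        | none =>
          cases i using Fin.cases with
          | zero => exact absurd rfl h
          | succ i => simp [psi, hζ]
    exact congrArg (fun g => g P) this
  rw [hP] at h2
  have h3 := u_indep Fin.succ (Fin.succ_injective _) g hg _ h2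
  rw [← h1 P, h3, map_zero]

theorem row_poly (d : ℕ) (hd : 1 ≤ d)
    (g : Fin r ⊕ κ → MvPolynomial (Fin r) F) (hg : ∀ l, g (Sum.inl l) = X l)
    (hgd : ∀ j, (g j).totalDegree ≤ d) (i0 : Fin (r+1)) :
    ∃ D : MvPolynomial (Fin (r+1) × Option (Fin r ⊕ κ)) F, D ≠ 0 ∧ psi g D = 0 ∧
      (scale (fun x : Fin (r+1) × Option (Fin r ⊕ κ) => if x.1 = i0 then 1 else 0) D).natDegree ≤ d ^ r := by
  obtain ⟨G, hG0, hGd, hG⟩ := norm_row d hd g hg hgd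
  obtain ⟨Θ, hΘ⟩ : ∃ Θ : MvPolynomial (Option (Fin r ⊕ κ)) (MvPolynomial (Fin r) (MvPolynomial (Fin r × (Fin r ⊕ κ)) F)) →+*
     MvPolynomial (Fin (r+1) × Option (Fin r ⊕ κ)) F, Θ =
      eval₂Hom (eval₂Hom (eval₂Hom C (fun x => X (i0.succAbove x.1, some x.2)))
        (fun i => X (i0.succAbove i, none))) (fun o => X (i0, o)) := ⟨_, rfl⟩
  obtain ⟨Φ, hΦ⟩ : ∃ Φ : MvPolynomial (Fin (r+1) × Option (Fin r ⊕ κ)) F →+*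
     MvPolynomial (Option (Fin r ⊕ κ)) (MvPolynomial (Fin r) (MvPolynomial (Fin r × (Fin r ⊕ κ)) F)),
     Φ = eval₂Hom (C.comp (C.comp C)) (fun x => Fin.insertNth (α := fun _ => MvPolynomial (Option (Fin r ⊕ κ)) (MvPolynomial (Fin r) (MvPolynomial (Fin r × (Fin r ⊕ κ)) F))) i0 (X x.2)
       (fun i => x.2.elim (C (X i)) (fun j => C (C (X (i, j))))) x.1) := ⟨_, rfl⟩
  obtain ⟨Ξ, hΞ⟩ : ∃ Ξ : MvPolynomial (Fin r ⊕ κ) (MvPolynomial (Fin r) (MvPolynomial (Fin r × (Fin r ⊕ κ)) F)) →+*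
      MvPolynomial (Fin (r+1) × (Fin r ⊕ κ)) (MvPolynomial (Fin r) F), Ξ =
      eval₂Hom (eval₂Hom (eval₂Hom (C.comp C) (fun x => X (i0.succAbove x.1, x.2))) (fun l => C (X l)))
       (fun j => X (i0, j)) := ⟨_, rfl⟩
  have h1 : ∀ P, Φ (Θ P) = P := by
    intro P
    have : Φ.comp Θ = RingHom.id _ := by
      apply ringHom_ext'
      · apply ringHom_ext'
        · apply ringHom_ext
          · intro a; simp [hΦ, hΘ]
          · intro a; simp [hΦ, hΘ]
        · intro a; simp [hΦ, hΘ]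
      · intro a; simp [hΦ, hΘ]
    exact congrArg (fun g => g P) this
  have hΞC : ∀ p : MvPolynomial (Fin r) F, Ξ (C (MvPolynomial.map C p)) = C p := by
    intro p
    have : (Ξ.comp C).comp (MvPolynomial.map C) = C := by
      apply ringHom_ext
      · intro a; simp [hΞ]
      · intro a; simp [hΞ]
    exact congrArg (fun g => g p) this
  have hΞX : ∀ j, Ξ (X j) = X (i0, j) := by simp [hΞ]
  have hΞCX : ∀ x, Ξ (C (C (X x))) = X (i0.succAbove x.1, x.2) := by simp [hΞ]
  have hΞCC : ∀ x, Ξ (C (C (C x))) = C (C x) := by simp [hΞ]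
  refine ⟨Θ G, fun h => hG0 (by rw [← h1 G, h, map_zero]), ?_, ?_⟩
  · rw [← map_zero Ξ, ← hG, ← RingHom.comp_apply, ← RingHom.comp_apply]
    congr 1
    apply ringHom_ext'
    · apply ringHom_ext'
      · apply ringHom_ext
        · intro a; simp [hΘ, psi, hΞCC]
        · intro a; simp [hΘ, psi, hΞCX]
      · intro a; simp [hΘ, psi, hΞCX, hΞC]
    · intro o
      cases o <;> simp [hΘ, psi, hΞX, hΞC]
  · refine le_trans ?_ hGd
    rw [← RingHom.comp_apply]
    have : (scale (fun x : Fin (r+1) × Option (Fin r ⊕ κ) => if x.1 = i0 then 1 else 0)).comp Θ =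
      eval₂Hom (Polynomial.C.comp (Θ.comp C)) (fun o => Polynomial.C (X (i0, o)) * Polynomial.X) := by
      apply ringHom_ext'
      · apply ringHom_ext'
        · apply ringHom_ext
          · intro a; simp [hΘ, scale]
          · intro a; simp [hΘ, scale]
        · intro a; simp [hΘ, scale]
      · intro a; simp [hΘ, scale]
    rw [this]
    apply natDegree_eval₂_le
    · intro a; simp
    · intro o; exact (Polynomial.natDegree_C_mul_le _ _).trans Polynomial.natDegree_X_le

theorem stepA (d : ℕ) (hd : 1 ≤ d)
    (g : Fin r ⊕ κ → MvPolynomial (Fin r) F) (hg : ∀ l, g (Sum.inl l) = X l)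
    (hgd : ∀ j, (g j).totalDegree ≤ d) :
    ∃ H : MvPolynomial (Fin (r+1) × Option (Fin r ⊕ κ)) F, H ≠ 0 ∧
      H.totalDegree ≤ (r + 1) * d ^ r ∧ psi g H = 0 := by
  classical
  choose D hD0 hDk hDd using row_poly d hd g hg hgd
  have : (RingHom.ker (psi g)).IsPrime := RingHom.ker_isPrime _
  obtain ⟨H, hH, hH0, hHd⟩ := gcd_mvpoly (0, none) (RingHom.ker (psi g))
    (fun P hP => psi_indep g hg P hP) (D 0) (hDk 0) (hD0 0)
  refine ⟨H, hH0, ?_, hH⟩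
  have := totalDegree_le_rows H (d ^ r) (fun i => by
    refine le_trans ?_ (hDd i)
    exact Polynomial.natDegree_le_of_dvd (map_dvd _ (hHd _ (hDk i))) (scale_ne_zero _ _ (hD0 i)))
  simpa using this

theorem stepA_eval (g : Fin r ⊕ κ → MvPolynomial (Fin r) F)
    (H : MvPolynomial (Fin (r+1) × Option (Fin r ⊕ κ)) F) (hH : psi g H = 0)
    {Ω : Type*} [CommRing Ω] (j : F →+* Ω) (z : Fin r → Ω)
    (y : Fin (r+1) × Option (Fin r ⊕ κ) → Ω)
    (hy : ∀ i, y (i, none) + ∑ a, y (i, some a) * eval₂Hom j z (g a) = 0) :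
    eval₂Hom j y H = 0 := by
  have : eval₂Hom j y = (eval₂Hom (eval₂Hom j z) (fun x => y (x.1, some x.2))).comp (psi g) := by
    apply ringHom_ext
    · intro a; simp [psi]
    · rintro ⟨i, o⟩
      cases o with
      | some a => simp [psi]
      | none =>
        have := hy i
        simp only [coe_eval₂Hom] at this
        simp [psi, eq_neg_of_add_eq_zero_left this]
  rw [this, RingHom.comp_apply, hH, map_zero]
end

theorem cdeg_eval₂ {σ M R S : Type*} [CommRing R] [CommRing S] {τ : Type*}
    (φ : R →+* MvPolynomial M (MvPolynomial τ S)) (y : σ → MvPolynomial M (MvPolynomial τ S))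
    (hφ : ∀ a β, (coeff β (φ a)).totalDegree = 0) (hy : ∀ o β, (coeff β (y o)).totalDegree ≤ 1)
    (G : MvPolynomial σ R) (β : M →₀ ℕ) : (coeff β (eval₂Hom φ y G)).totalDegree ≤ G.totalDegree := by
  classical
  have hmul : ∀ (P Q : MvPolynomial M (MvPolynomial τ S)) (a b : ℕ),
      (∀ β, (coeff β P).totalDegree ≤ a) → (∀ β, (coeff β Q).totalDegree ≤ b) →
      ∀ β, (coeff β (P * Q)).totalDegree ≤ a + b := by
    intro P Q a b hP hQ β
    rw [coeff_mul]
    exact totalDegree_finsetSum_le fun x _ => (totalDegree_mul _ _).trans (add_le_add (hP _) (hQ _))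
  have hone : ∀ β, (coeff β (1 : MvPolynomial M (MvPolynomial τ S))).totalDegree ≤ 0 := by
    intro β
    rw [coeff_one]
    split_ifs <;> simp
  have hpow : ∀ (P : MvPolynomial M (MvPolynomial τ S)), (∀ β, (coeff β P).totalDegree ≤ 1) →
      ∀ (e : ℕ) (β), (coeff β (P ^ e)).totalDegree ≤ e := by
    intro P hP e
    induction e with
    | zero => simpa using hone
    | succ e ih => rw [pow_succ]; exact hmul _ _ _ _ ih hP
  have hprod : ∀ (s : Finset σ) (α : σ → ℕ) (β), (coeff β (∏ o ∈ s, y o ^ α o)).totalDegree ≤ ∑ o ∈ s, α o := by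
    intro s α
    induction s using Finset.induction_on with
    | empty => simpa using hone
    | insert a s ha ih =>
      rw [Finset.prod_insert ha, Finset.sum_insert ha]
      exact hmul _ _ _ _ (hpow _ (hy a) _) ih
  rw [coe_eval₂Hom, eval₂_eq, coeff_sum]
  refine totalDegree_finsetSum_le fun α hα => ?_
  refine (hmul _ _ 0 _ (fun β => (hφ _ β).le) (hprod _ _) β).trans ?_
  rw [zero_add]
  exact le_totalDegree hα

theorem stepB {F : Type} [Field F] {r : ℕ} {κ : Type} [Fintype κ] (d : ℕ) (hd : 1 ≤ d)
    (f : κ → MvPolynomial (Fin r) F) (hf : ∀ j, (f j).totalDegree ≤ d) :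
    ∃ H : MvPolynomial (Fin (r+1) × κ) F, H ≠ 0 ∧ H.totalDegree ≤ (r + 1) * d ^ r ∧
      ∀ (Ω : Type) [Field Ω] (j : F →+* Ω) (z : Fin r → Ω) (Λ : Fin (r+1) × κ → Ω) (j0 : κ),
        eval₂Hom j z (f j0) ≠ 0 → (∀ i, ∑ a, Λ (i, a) * eval₂Hom j z (f a) = 0) →
        eval₂Hom j Λ H = 0 := by
  classical
  obtain ⟨H₀, hH0, hHd, hH⟩ := stepA d hd (Sum.elim X f) (fun _ => rfl) (by
    rintro (l | j)
    · simpa using hd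
    · exact hf j)
  obtain ⟨conv, hconv⟩ : ∃ conv : MvPolynomial (Fin (r+1) × Option (Fin r ⊕ κ)) F →+*
      MvPolynomial (Fin (r+1) × Option (Fin r)) (MvPolynomial (Fin (r+1) × κ) F),
      conv = eval₂Hom (C.comp C) (fun x => x.2.elim (X (x.1, none))
        (Sum.elim (fun l => X (x.1, some l)) (fun j => C (X (x.1, j))))) := ⟨_, rfl⟩
  obtain ⟨back, hback⟩ : ∃ back : MvPolynomial (Fin (r+1) × Option (Fin r)) (MvPolynomial (Fin (r+1) × κ) F)
      →+* MvPolynomial (Fin (r+1) × Option (Fin r ⊕ κ)) F,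
      back = eval₂Hom (eval₂Hom C (fun x => X (x.1, some (Sum.inr x.2))))
        (fun x => X (x.1, x.2.map Sum.inl)) := ⟨_, rfl⟩
  have hbc : ∀ P, back (conv P) = P := by
    intro P
    have : back.comp conv = RingHom.id _ := by
      apply ringHom_ext
      · intro a; simp [hback, hconv]
      · rintro ⟨i, (_ | l | j)⟩ <;> simp [hback, hconv]
    exact congrArg (fun g => g P) this
  obtain ⟨β, hβ, hmin⟩ := exists_min_support (conv H₀) (fun h => hH0 (by rw [← hbc H₀, h, map_zero]))
  refine ⟨coeff β (conv H₀), hβ, ?_, ?_⟩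
  · refine le_trans ?_ hHd
    rw [hconv]
    apply cdeg_eval₂
    · intro a β
      rw [RingHom.comp_apply, coeff_C]
      split_ifs <;> simp
    · rintro ⟨i, (_ | l | j)⟩ β
      · simp only [Option.elim, coeff_X]
        split_ifs <;> simp
      · simp only [Option.elim, Sum.elim_inl, coeff_X]
        split_ifs <;> simp
      · simp only [Option.elim, Sum.elim_inr, coeff_C]
        split_ifs <;> simp
  · intro Ω _ j z Λ j0 hj0 hΛ
    obtain ⟨θ, hθ⟩ : ∃ θ : MvPolynomial (Fin (r+1) × Option (Fin r)) (MvPolynomial (Fin (r+1) × κ) F) →+*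
        MvPolynomial (Fin (r+1) × Option (Fin r)) Ω,
        θ = eval₂Hom (eval₂Hom (C.comp j) (fun x => C (Λ x) - if x.2 = j0 then
          (X (x.1, none) + ∑ l, X (x.1, some l) * C (z l)) * C ((eval₂Hom j z (f j0))⁻¹) else 0)) X :=
      ⟨_, rfl⟩
    have h1 := lowest_order θ (by intro i; simp [hθ]) (conv H₀) β hmin
    have h2 : θ (conv H₀) = 0 := by
      have hc : θ.comp conv = eval₂Hom (C.comp j) (fun x => θ (conv (X x))) := by
        apply ringHom_ext
        · intro a; simp [hconv, hθ]
        · intro x; simp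
      rw [← RingHom.comp_apply, hc]
      refine stepA_eval (Sum.elim X f) H₀ hH (C.comp j) (fun l => C (z l)) _ ?_
      intro i
      have hCe : ∀ p, eval₂ (C.comp j) (fun l => C (z l)) p =
          (C (eval₂Hom j z p) : MvPolynomial (Fin (r+1) × Option (Fin r)) Ω) := by
        intro p
        exact (RingHom.congr_fun (comp_eval₂Hom j z C) p).symm
      have h3 : ∑ a, (C (Λ (i, a)) * C (eval₂Hom j z (f a)) : MvPolynomial (Fin (r+1) × Option (Fin r)) Ω) = 0 := by
        simp_rw [← C_mul]
        rw [← map_sum, hΛ, map_zero]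
      have h4 : (C (eval₂Hom j z (f j0))⁻¹ * C (eval₂Hom j z (f j0)) : MvPolynomial (Fin (r+1) × Option (Fin r)) Ω) = 1 := by
        rw [← C_mul, inv_mul_cancel₀ hj0, C_1]
      simp only [Fintype.sum_sum_type, coe_eval₂Hom, hCe, Sum.elim_inl, Sum.elim_inr, hconv, hθ,
        eval₂_X, Option.elim, eval₂_C, sub_mul, Finset.sum_sub_distrib, ite_mul, zero_mul,
        Finset.sum_ite_eq', Finset.mem_univ, if_true]
      simp only [coe_eval₂Hom] at h3 h4
      rw [h3, mul_assoc _ (C _) (C _), h4]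
      ring
    rw [h2, coeff_zero] at h1
    rw [h1]
    have h5 : eval₂Hom j Λ = (constantCoeff.comp θ).comp C := by
      apply ringHom_ext
      · intro a; simp [hθ]
      · intro x
        simp [hθ, apply_ite constantCoeff]
    rw [h5]; rfl

theorem height_le_map_C {A : Type*} [CommRing A] [IsNoetherianRing A] (q : Ideal A) [q.IsPrime] :
    q.height ≤ (q.map (Polynomial.C : A →+* Polynomial A)).height := by
  have hl : (q.map (Polynomial.C : A →+* Polynomial A)).LiesOver q := by
    constructor
    ext a
    rw [Ideal.mem_comap, Polynomial.algebraMap_eq, Ideal.mem_map_C_iff]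
    constructor
    · intro ha n
      rw [Polynomial.coeff_C]
      split_ifs
      · exact ha
      · exact q.zero_mem
    · intro h
      simpa using h 0
  rw [Ideal.height_eq_height_add_of_liesOver_of_hasGoingDown q (q.map (Polynomial.C : A →+* Polynomial A))]
  exact le_self_add

theorem height_indep {F : Type*} [Field F] (N : ℕ) (P : Ideal (MvPolynomial (Fin N) F)) [hP : P.IsPrime] :
    ∃ (e : ℕ) (τ : Fin e → Fin N), (N : ℕ∞) ≤ P.height + e ∧
      ∀ Q : MvPolynomial (Fin e) F, rename τ Q ∈ P → Q = 0 := by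
  classical
  induction N with
  | zero =>
    refine ⟨0, id, by simp, fun Q hQ => ?_⟩
    by_contra h
    rw [rename_id, AlgHom.id_apply] at hQ
    rw [eq_C_of_isEmpty Q] at hQ h
    rw [C_eq_zero] at h
    exact hP.ne_top (Ideal.eq_top_of_isUnit_mem _ hQ ((isUnit_iff_ne_zero.mpr h).map C))
  | succ N ih =>
    obtain ⟨P', hP'⟩ : ∃ P', P' = P.comap (finSuccEquiv F N).symm.toRingEquiv := ⟨_, rfl⟩
    have hP'p : P'.IsPrime := by rw [hP']; infer_instance
    have hht : P'.height = P.height := by rw [hP']; exact RingEquiv.height_comap _ _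
    have hmem : ∀ x, x ∈ P → finSuccEquiv F N x ∈ P' := by
      intro x hx
      rw [hP', Ideal.mem_comap]
      simpa using hx
    obtain ⟨q, hq⟩ : ∃ q, q = P'.comap (Polynomial.C) := ⟨_, rfl⟩
    have hqp : q.IsPrime := by rw [hq]; infer_instance
    obtain ⟨e, τ, hle, hind⟩ := ih q
    have hqle : q.map Polynomial.C ≤ P' := by
      rw [hq]; exact Ideal.map_comap_le
    by_cases hPq : q.map Polynomial.C = P'
    · refine ⟨e + 1, Fin.cons 0 (Fin.succ ∘ τ), ?_, fun Q hQ => ?_⟩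
      · have h1 := height_le_map_C q
        rw [hPq, hht] at h1
        push_cast
        rw [← add_assoc]
        gcongr
        exact hle.trans (by gcongr)
      · have h1 := hmem _ hQ
        have h2 : finSuccEquiv F N (rename (Fin.cons 0 (Fin.succ ∘ τ)) Q) =
            Polynomial.map (rename τ : _ →ₐ[F] _).toRingHom (finSuccEquiv F e Q) := by
          have : ((finSuccEquiv F N).toRingEquiv.toRingHom).comp (rename (Fin.cons 0 (Fin.succ ∘ τ)) : MvPolynomial (Fin (e+1)) F →ₐ[F] MvPolynomial (Fin (N+1)) F).toRingHom =
            (Polynomial.mapRingHom (rename τ : _ →ₐ[F] _).toRingHom).comp (finSuccEquiv F e).toRingEquiv.toRingHom := by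
            apply ringHom_ext
            · intro a; simp [finSuccEquiv_apply]
            · intro i
              cases i using Fin.cases <;> simp [finSuccEquiv_apply]
          exact congrArg (fun g => g Q) this
        rw [h2, ← hPq, Ideal.mem_map_C_iff] at h1
        have h3 : finSuccEquiv F e Q = 0 := by
          ext1 n
          apply hind
          have := h1 n
          rwa [Polynomial.coeff_map] at this
        simpa using h3
    · refine ⟨e, Fin.succ ∘ τ, ?_, fun Q hQ => ?_⟩
      · have h1 := height_le_map_C q
        have h2 := Ideal.height_add_one_le_of_lt_of_isPrime (lt_of_le_of_ne hqle hPq)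
        rw [hht] at h2
        push_cast
        calc (N : ℕ∞) + 1 ≤ q.height + e + 1 := by gcongr
          _ ≤ (q.map Polynomial.C).height + 1 + e := by
            rw [add_right_comm]; gcongr
          _ ≤ _ := by gcongr
      · apply hind
        rw [hq, Ideal.mem_comap]
        have h1 := hmem _ hQ
        have h2 : finSuccEquiv F N (rename (Fin.succ ∘ τ) Q) = Polynomial.C (rename τ Q) := by
          have : ((finSuccEquiv F N).toRingEquiv.toRingHom).comp (rename (Fin.succ ∘ τ) : MvPolynomial (Fin e) F →ₐ[F] MvPolynomial (Fin (N+1)) F).toRingHom =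
            Polynomial.C.comp (rename τ : _ →ₐ[F] _).toRingHom := by
            apply ringHom_ext
            · intro a; simp [finSuccEquiv_apply]
            · intro i; simp [finSuccEquiv_apply]
          exact congrArg (fun g => g Q) this
        rwa [h2] at h1

theorem totalDegree_eval₂_le {J R S τ : Type*} [CommRing R] [CommRing S] (φ : R →+* MvPolynomial τ S)
    (y : J → MvPolynomial τ S) (hφ : ∀ a, (φ a).totalDegree = 0) (hy : ∀ o, (y o).totalDegree ≤ 1)
    (G : MvPolynomial J R) : (eval₂Hom φ y G).totalDegree ≤ G.totalDegree := by
  rw [coe_eval₂Hom, eval₂_eq]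
  refine totalDegree_finsetSum_le fun β hβ => ?_
  refine (totalDegree_mul _ _).trans ?_
  rw [hφ, zero_add]
  refine (totalDegree_finsetProd _ _).trans ?_
  refine le_trans ?_ (le_totalDegree hβ)
  refine Finset.sum_le_sum fun o _ => ?_
  refine (totalDegree_pow _ _).trans ?_
  calc _ ≤ β o * 1 := Nat.mul_le_mul_left _ (hy o)
    _ = _ := mul_one _

theorem functional {k F σ : Type*} [Field k] [Field F] [Algebra k F] (H1 : MvPolynomial σ F) (h1 : H1 ≠ 0) :
    ∃ H : MvPolynomial σ k, H ≠ 0 ∧ H.totalDegree ≤ H1.totalDegree ∧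
      ∀ Λ : σ → k, eval (fun x => algebraMap k F (Λ x)) H1 = 0 → eval Λ H = 0 := by
  classical
  obtain ⟨β, hβ⟩ := ne_zero_iff.mp h1
  obtain ⟨l, hl⟩ : ∃ l : F →ₗ[k] k, l (coeff β H1) ≠ 0 := by
    by_contra! h
    exact hβ ((Module.forall_dual_apply_eq_zero_iff k _).mp h)
  refine ⟨∑ α ∈ H1.support, monomial α (l (coeff α H1)), ?_, ?_, ?_⟩
  · rw [ne_zero_iff]
    refine ⟨β, ?_⟩
    rw [coeff_sum]
    simp only [coeff_monomial, Finset.sum_ite_eq']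
    rwa [if_pos (mem_support_iff.mpr hβ)]
  · refine totalDegree_finsetSum_le fun α hα => ?_
    exact (totalDegree_monomial_le _ _).trans (le_totalDegree hα)
  · intro Λ h
    rw [eval_eq] at h
    have h2 := congrArg l h
    rw [map_zero, map_sum] at h2
    rw [map_sum, ← h2]
    refine Finset.sum_congr rfl fun α _ => ?_
    rw [eval_monomial, Finsupp.prod]
    simp_rw [← map_pow]
    rw [← map_prod, mul_comm (coeff α H1), ← Algebra.smul_def, map_smul, smul_eq_mul, mul_comm]

noncomputable abbrev TT (n e : ℕ) : Type := MvPolynomial (Fin e) (MvPolynomial (Fin (n+1) × Fin (n+1)) ℂ)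

section
variable {n r e m : ℕ}

theorem embed {F : Type} [Field F] [Algebra (TT n e) F]
    [IsFractionRing (TT n e) F] {K Ω : Type} [Field K] [Algebra ℂ K] [Field Ω]
    [Algebra (MvPolynomial (Fin (n+1) × Fin (n+1)) K) Ω]
    [IsFractionRing (MvPolynomial (Fin (n+1) × Fin (n+1)) K) Ω]
    (idx : Fin e ⊕ Fin r ≃ Fin (n+1)) (ξ : Fin (n+1) → K) (τ : Fin e → Fin (n+1))
    (hτ : ∀ Q : MvPolynomial (Fin e) ℂ, aeval (fun i => ξ (τ i)) Q = 0 → Q = 0) :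
    ∃ j : F →+* Ω, (∀ c, j (algebraMap (TT n e) F (C (C c))) = algebraMap (MvPolynomial (Fin (n+1) × Fin (n+1)) K) Ω (C (algebraMap ℂ K c))) ∧
      (∀ x, j (algebraMap (TT n e) F (C (X x))) = algebraMap (MvPolynomial (Fin (n+1) × Fin (n+1)) K) Ω (X x)) ∧
      (∀ i, j (algebraMap (TT n e) F (X i)) =
        ∑ l, algebraMap (MvPolynomial (Fin (n+1) × Fin (n+1)) K) Ω (X (idx (Sum.inl i), l)) * algebraMap (MvPolynomial (Fin (n+1) × Fin (n+1)) K) Ω (C (ξ l))) := by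
  classical
  have hinj := generic_inj (F := ℂ) (B := K) (fun i : Fin e => ∑ l, X (idx (Sum.inl i), l) * C (ξ l))
    (fun x : Fin (n+1) × Fin (n+1) =>
      Sum.elim (fun i => if x.2 = τ i then (1:ℂ) else 0) (fun _ => 0) (idx.symm x.1)) (by
    intro Q hQ
    apply hτ
    rw [← hQ]
    congr 2
    funext i
    simp [apply_ite])
  have hinj2 : Function.Injective ((algebraMap (MvPolynomial (Fin (n+1) × Fin (n+1)) K) Ω).comp
      (eval₂Hom (MvPolynomial.map (algebraMap ℂ K)) (fun i : Fin e => ∑ l, X (idx (Sum.inl i), l) * C (ξ l)))) := by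
    rw [RingHom.coe_comp]
    refine (IsFractionRing.injective _ Ω).comp ?_
    rw [injective_iff_map_eq_zero]
    exact hinj
  refine ⟨IsFractionRing.lift hinj2, ?_, ?_, ?_⟩
  · intro c
    rw [IsFractionRing.lift_algebraMap]; simp
  · intro x
    rw [IsFractionRing.lift_algebraMap]; simp
  · intro x
    rw [IsFractionRing.lift_algebraMap]; simp

theorem stepD_abs (F : Type) [Field F] [Algebra (TT n e) F]
    [IsFractionRing (TT n e) F] (d : ℕ) (hd : 1 ≤ d) (idx : Fin e ⊕ Fin r ≃ Fin (n+1))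
    (f : Fin m → MvPolynomial (Fin (n+1)) ℂ) (hf : ∀ a, (f a).totalDegree ≤ d) :
    ∃ H : MvPolynomial (Fin (r+1) × Fin m) ℂ, H ≠ 0 ∧ H.totalDegree ≤ (r + 1) * d ^ r ∧
      ∀ (K Ω : Type) [Field K] [Algebra ℂ K] [Field Ω]
        [Algebra (MvPolynomial (Fin (n+1) × Fin (n+1)) K) Ω]
        [IsFractionRing (MvPolynomial (Fin (n+1) × Fin (n+1)) K) Ω]
        (ξ : Fin (n+1) → K) (τ : Fin e → Fin (n+1)),
        (∀ Q : MvPolynomial (Fin e) ℂ, aeval (fun i => ξ (τ i)) Q = 0 → Q = 0) →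
        ∀ (Λ : Fin (r+1) × Fin m → ℂ) (j0 : Fin m), aeval ξ (f j0) ≠ 0 →
        (∀ i, ∑ a, algebraMap ℂ K (Λ (i, a)) * aeval ξ (f a) = 0) → eval Λ H = 0 := by
  classical
  obtain ⟨ι, hι⟩ : ∃ ι : ℂ →+* F, ι = (algebraMap (TT n e) F).comp
    (C.comp C) := ⟨_, rfl⟩
  obtain ⟨ν, hν⟩ : ∃ ν : MvPolynomial (Fin (n+1) × Fin (n+1)) ℂ →+* F, ν = (algebraMap (TT n e) F).comp
    C := ⟨_, rfl⟩
  have hνinj : Function.Injective ν := by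
    rw [hν, RingHom.coe_comp]
    exact (IsFractionRing.injective _ F).comp (C_injective _ _)
  obtain ⟨M, hM⟩ : ∃ M : Matrix (Fin (n+1)) (Fin (n+1)) F, M = (Matrix.mvPolynomialX (Fin (n+1)) (Fin (n+1)) ℂ).map ν :=
    ⟨_, rfl⟩
  have hMinv : M⁻¹ * M = 1 := by
    apply Matrix.nonsing_inv_mul
    rw [isUnit_iff_ne_zero, hM]
    have : (Matrix.mvPolynomialX (Fin (n+1)) (Fin (n+1)) ℂ).map ν = ν.mapMatrix (Matrix.mvPolynomialX (Fin (n+1)) (Fin (n+1)) ℂ) := rfl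
    rw [this, ← RingHom.map_det]
    exact (map_ne_zero_iff ν hνinj).mpr (Matrix.det_mvPolynomialX_ne_zero _ _)
  obtain ⟨lin, hlin⟩ : ∃ lin : Fin (n+1) → MvPolynomial (Fin r) F, lin = fun i =>
    ∑ s : Fin e ⊕ Fin r, C (M⁻¹ i (idx s)) * (Sum.elim (fun y => C (algebraMap (TT n e) F (X y))) X s) := ⟨_, rfl⟩
  obtain ⟨H1, hH1, hH1d, hH1e⟩ := stepB d hd (fun a => eval₂Hom (C.comp ι) lin (f a)) (by
    intro a
    refine (totalDegree_eval₂_le _ _ ?_ ?_ _).trans (hf a)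
    · intro c; simp
    · intro i
      rw [hlin]
      refine totalDegree_finsetSum_le fun s _ => (totalDegree_mul _ _).trans ?_
      rw [totalDegree_C, zero_add]
      rcases s with s | s <;> simp)
  let _ : Algebra ℂ F := ι.toAlgebra
  obtain ⟨H, hH, hHd, hHe⟩ := functional (k := ℂ) H1 hH1
  refine ⟨H, hH, hHd.trans hH1d, ?_⟩
  intro K Ω _ _ _ _ _ ξ τ hτ Λ j0 hj0 hΛ
  apply hHe
  obtain ⟨j, hj1, hj2, hj3⟩ := embed (F := F) (Ω := Ω) idx ξ τ hτ
  obtain ⟨μ, hμ⟩ : ∃ μ : K →+* Ω, μ = (algebraMap (MvPolynomial (Fin (n+1) × Fin (n+1)) K) Ω).comp C := ⟨_, rfl⟩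
  have hjι : j.comp ι = μ.comp (algebraMap ℂ K) := by
    refine RingHom.ext fun c => ?_
    rw [hι, hμ]
    exact hj1 c
  apply j.injective
  rw [map_zero]
  -- the remaining coordinates
  obtain ⟨z, hz⟩ : ∃ z : Fin r → Ω, z = fun i =>
    ∑ l, algebraMap (MvPolynomial (Fin (n+1) × Fin (n+1)) K) Ω (X (idx (Sum.inr i), l)) * μ (ξ l) := ⟨_, rfl⟩
  have hjM : ∀ x y, j (M x y) = algebraMap (MvPolynomial (Fin (n+1) × Fin (n+1)) K) Ω (X (x, y)) := by
    intro x y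
    rw [hM, hν]
    exact hj2 (x, y)
  have hlinz : ∀ i, eval₂Hom j z (lin i) = μ (ξ i) := by
    intro i
    have h1 : ∀ s, eval₂Hom j z (Sum.elim (fun y => C (algebraMap (TT n e) F (X y))) X s) =
      ∑ l, j (M (idx s) l) * μ (ξ l) := by
      rintro (s | s)
      · simp only [Sum.elim_inl, eval₂Hom_C, hj3, hjM, hμ, RingHom.comp_apply]
      · simp only [Sum.elim_inr, eval₂Hom_X', hz, hjM]
    rw [hlin]
    simp only [map_sum, map_mul, h1, eval₂Hom_C]
    rw [Equiv.sum_comp idx (fun x => j (M⁻¹ i x) * ∑ l, j (M x l) * μ (ξ l))]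
    simp_rw [Finset.mul_sum]
    rw [Finset.sum_comm]
    simp_rw [← mul_assoc, ← map_mul, ← Finset.sum_mul, ← map_sum]
    have h2 : ∀ l, ∑ x, M⁻¹ i x * M x l = (1 : Matrix (Fin (n+1)) (Fin (n+1)) F) i l := by
      intro l
      rw [← hMinv, Matrix.mul_apply]
    simp_rw [h2, Matrix.one_apply]
    simp [apply_ite]
  have hfe : ∀ a, eval₂Hom j z (eval₂Hom (C.comp ι) lin (f a)) = μ (aeval ξ (f a)) := by
    intro a
    have : (eval₂Hom j z).comp (eval₂Hom (C.comp ι) lin) = μ.comp (aeval ξ : _ →ₐ[ℂ] K).toRingHom := by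
      apply ringHom_ext
      · intro c
        have := RingHom.congr_fun hjι c
        simpa using this
      · intro i
        have := hlinz i
        simpa using this
    exact congrArg (fun g => g (f a)) this
  have hfin := hH1e Ω j z (fun x => μ (algebraMap ℂ K (Λ x))) j0 (by
    rw [hfe]
    exact (map_ne_zero μ).mpr hj0) (by
    intro i
    simp only [hfe]
    rw [← map_zero μ, ← hΛ i, map_sum]
    simp)
  rw [← hfin]
  have h5 : eval₂Hom j (fun x => μ (algebraMap ℂ K (Λ x))) = j.comp (eval (fun x => algebraMap ℂ F (Λ x))) := by
    apply ringHom_ext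
    · intro c; simp
    · intro x
      have := RingHom.congr_fun hjι (Λ x)
      rw [eval₂Hom_X', RingHom.comp_apply, eval_X]
      exact this.symm
  rw [h5]; rfl
end

/-- For homogeneous `f_1, …, f_m` of degree `d` in `ℂ[x_0, …, x_n]`
there is a nonzero polynomial `H` of degree at most `k·d^(k−1)` in the entries of
a `k×m` matrix `Λ` such that whenever `H(Λ) ≠ 0`, every minimal prime over the
ideal of the `k` linear combinations `Σ_j Λ_{sj} f_j` is either a minimal prime
over `⟨f_1, …, f_m⟩` or has height exactly `k`. -/
theorem generic_linear_combinations (n m k d : ℕ)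
    (hn : 1 ≤ n) (hm : 1 ≤ m) (hk1 : 1 ≤ k) (hkn : k ≤ n) (hd : 1 ≤ d)
    (f : Fin m → MvPolynomial (Fin (n + 1)) ℂ)
    (hf : ∀ j : Fin m, (f j).IsHomogeneous d) :
    ∃ H : MvPolynomial (Fin k × Fin m) ℂ, H ≠ 0 ∧
      H.totalDegree ≤ k * d ^ (k - 1) ∧
      ∀ Λ : Fin k → Fin m → ℂ,
        MvPolynomial.eval (fun p : Fin k × Fin m => Λ p.1 p.2) H ≠ 0 →
        ∀ p ∈ (Ideal.span
            (Set.range fun s : Fin k => ∑ j : Fin m, Λ s j • f j)).minimalPrimes,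
          p ∈ (Ideal.span (Set.range f)).minimalPrimes ∨
          ∃ hp : p.IsPrime,
            Order.height (⟨p, hp⟩ :
              PrimeSpectrum (MvPolynomial (Fin (n + 1)) ℂ)) = (k : ℕ∞) := by
  classical
  obtain ⟨r, rfl⟩ : ∃ r, k = r + 1 := ⟨k - 1, by omega⟩
  have hidx : (n + 1 - r) + r = n + 1 := by omega
  obtain ⟨H, hH, hHd, hHe⟩ := stepD_abs (m := m) (FractionRing (TT n (n + 1 - r))) d hd
    (finSumFinEquiv.trans (finCongr hidx)) f
    (fun a => (hf a).totalDegree_le)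
  refine ⟨H, hH, by simpa using hHd, ?_⟩
  intro Λ hΛ p hp
  have hpp : p.IsPrime := hp.1.1
  by_cases hall : ∀ j, f j ∈ p
  · left
    refine ⟨⟨hpp, ?_⟩, ?_⟩
    · rw [Ideal.span_le]
      rintro _ ⟨j, rfl⟩
      exact hall j
    · rintro q ⟨hq, hfq⟩ hqp
      refine hp.2 ⟨hq, le_trans ?_ hfq⟩ hqp
      rw [Ideal.span_le]
      rintro _ ⟨s, rfl⟩
      refine Submodule.sum_mem _ fun j _ => ?_
      rw [smul_eq_C_mul]
      exact Ideal.mul_mem_left _ _ (Ideal.subset_span ⟨j, rfl⟩)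
  · right
    push Not at hall
    obtain ⟨j0, hj0⟩ := hall
    refine ⟨hpp, ?_⟩
    rw [← PrimeSpectrum.height_eq_orderHeight]
    change p.height = _
    have hle : p.height ≤ ((r + 1 : ℕ) : ℕ∞) := by
      refine (Ideal.height_le_card_of_mem_minimalPrimes_span (Set.finite_range _) hp).trans ?_
      have h1 := Set.ncard_image_le (f := fun s : Fin (r + 1) => ∑ j : Fin m, Λ s j • f j)
        (Set.finite_univ)
      rw [Set.image_univ, Set.ncard_univ, Nat.card_eq_fintype_card, Fintype.card_fin] at h1
      exact_mod_cast h1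
    refine le_antisymm hle ?_
    by_contra hlt
    rw [not_le] at hlt
    obtain ⟨e, τ, he, hτ⟩ := height_indep (n + 1) p
    have hee : n + 1 - r ≤ e := by
      obtain ⟨h, hh⟩ := ENat.ne_top_iff_exists.mp (ne_top_of_lt hlt)
      rw [← hh] at hlt he
      norm_cast at hlt he
      omega
    apply hΛ
    let K := FractionRing (MvPolynomial (Fin (n + 1)) ℂ ⧸ p)
    have hmk : ∀ P : MvPolynomial (Fin (n + 1)) ℂ,
        aeval (fun i => algebraMap (MvPolynomial (Fin (n + 1)) ℂ ⧸ p) K (Ideal.Quotient.mk p (X i))) P =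
        algebraMap (MvPolynomial (Fin (n + 1)) ℂ ⧸ p) K (Ideal.Quotient.mk p P) := by
      intro P
      have : aeval (fun i => algebraMap (MvPolynomial (Fin (n + 1)) ℂ ⧸ p) K
          (Ideal.Quotient.mk p (X i))) =
          (IsScalarTower.toAlgHom ℂ (MvPolynomial (Fin (n + 1)) ℂ ⧸ p) K).comp
            (Ideal.Quotient.mkₐ ℂ p) := by
        ext i
        rw [aeval_X]
        rfl
      exact congrArg (fun g => g P) this
    have hmk0 : ∀ P : MvPolynomial (Fin (n + 1)) ℂ,
        algebraMap (MvPolynomial (Fin (n + 1)) ℂ ⧸ p) K (Ideal.Quotient.mk p P) = 0 ↔ P ∈ p := by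
      intro P
      rw [map_eq_zero_iff _ (IsFractionRing.injective _ K), Ideal.Quotient.eq_zero_iff_mem]
    refine hHe K (FractionRing (MvPolynomial (Fin (n+1) × Fin (n+1)) K))
      (fun i => algebraMap (MvPolynomial (Fin (n + 1)) ℂ ⧸ p) K (Ideal.Quotient.mk p (X i)))
      (fun i => τ (Fin.castLE hee i)) ?_ _ j0 ?_ ?_
    · intro Q hQ
      have h1 := hmk (rename (fun i => τ (Fin.castLE hee i)) Q)
      rw [aeval_rename] at h1
      have h2 := (hmk0 _).mp (h1.symm.trans hQ)
      have h3 : rename (fun i => τ (Fin.castLE hee i)) Q = rename τ (rename (Fin.castLE hee) Q) := by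
        rw [rename_rename]; rfl
      rw [h3] at h2
      exact rename_injective _ (Fin.castLE_injective hee) (by rw [hτ _ h2, map_zero])
    · rw [hmk, Ne, hmk0]
      exact hj0
    · intro i
      have h1 : ∑ j : Fin m, Λ i j • f j ∈ p := hp.1.2 (Ideal.subset_span ⟨i, rfl⟩)
      rw [← hmk0, ← hmk, map_sum] at h1
      rw [← h1]
      refine Finset.sum_congr rfl fun a _ => ?_
      rw [map_smul, Algebra.smul_def]
end

section
/- Let n, m ≥ 1, let 1 ≤ k ≤ n, let d ≥ 1, set N = ⌈m/k⌉, and let f_1, …, f_m ∈ ℂ[x_0, …, x_n] be homogeneous polynomials of degree d. Then there exists a nonzero polynomial H in the N·k·m entries of a tuple (Λ^1, …, Λ^N) of k×m complex matrices, of total degree at most N·k·d^{k−1} + m, such that whenever H(Λ^1, …, Λ^N) ≠ 0 the following two statements hold: (a) for each i ∈ [N], every minimal prime over the ideal generated by the k linear combinations Σ_{j=1}^m Λ^i_{sj} f_j (s = 1, …, k) is either a minimal prime over ⟨f_1, …, f_m⟩ or has height exactly k; and (b) the ideal of ℂ[x_0, …, x_n] generated by all N·k linear combinations Σ_j Λ^i_{sj}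 f_j (i ∈ [N], s ∈ [k]) equals ⟨f_1, …, f_m⟩. -/
open MvPolynomial

theorem aux_algInd_cons {K B : Type} [CommRing K] [CommRing B] [Algebra K B] {t : ℕ} {x : Fin t → B}
    (hx : AlgebraicIndependent K x) {a : B}
    (ha : Transcendental (Algebra.adjoin K (Set.range x)) a) :
    AlgebraicIndependent K (Fin.cons a x : Fin (t + 1) → B) := by
  rw [← AlgebraicIndependent.option_iff_transcendental hx] at ha
  refine (algebraicIndependent_equiv' (_root_.finSuccEquiv t) ?_).2 ha
  funext i
  refine Fin.cases ?_ (fun i => ?_) i <;> simp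

theorem aux_height_ker {K B : Type} [Field K] [CommRing B] [IsDomain B] [Algebra K B] (n : ℕ) :
    ∀ (θ : MvPolynomial (Fin n) K →ₐ[K] B) (h : ℕ), (RingHom.ker θ.toRingHom).height ≤ (h : ℕ∞) →
    ∃ (t : ℕ) (y : Fin t → Fin n), AlgebraicIndependent K (fun i => θ (X (y i))) ∧ n ≤ t + h := by
  induction n with
  | zero =>
    intro θ h _
    exact ⟨0, Fin.elim0, by
      have := algebraicIndependent_empty_type_iff (ι := Fin 0) (R := K) (x := fun i => θ (X (Fin.elim0 i)))
      rw [this]; exact (algebraMap K B).injective, by omega⟩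
  | succ n ih =>
    intro θ h hh
    let e := (MvPolynomial.finSuccEquiv K n)
    let Θ : Polynomial (MvPolynomial (Fin n) K) →ₐ[K] B := θ.comp e.symm.toAlgHom
    have hΘ : ∀ x, Θ (e x) = θ x := by intro x; simp [Θ]
    let Q := RingHom.ker Θ.toRingHom
    have hQ : Q.height ≤ (h : ℕ∞) := by
      have : RingHom.ker θ.toRingHom = Q.comap e.toRingEquiv := by
        ext x
        change θ x = 0 ↔ Θ (e x) = 0
        rw [hΘ]
      rw [this, RingEquiv.height_comap] at hh
      exact hh
    have : Q.IsPrime := RingHom.ker_isPrime _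
    let θ' : MvPolynomial (Fin n) K →ₐ[K] B := θ.comp (rename Fin.succ)
    have hθ' : ∀ x, θ' x = Θ (Polynomial.C x) := by
      intro x
      have : e (rename Fin.succ x) = Polynomial.C x := by
        have h3 : (e.toAlgHom.comp (rename Fin.succ)) =
            (IsScalarTower.toAlgHom K (MvPolynomial (Fin n) K) (Polynomial (MvPolynomial (Fin n) K))) := by
          ext i
          simp [e, finSuccEquiv_X_succ]
        exact DFunLike.congr_fun h3 x
      rw [← this, hΘ]; rfl
    let p := RingHom.ker θ'.toRingHom
    have : p.IsPrime := RingHom.ker_isPrime _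
    have hpQ : p = Q.comap Polynomial.C := by
      ext x
      change θ' x = 0 ↔ Θ (Polynomial.C x) = 0
      rw [hθ']
    have : Q.LiesOver p := ⟨hpQ⟩
    have key := Ideal.height_eq_height_add_of_liesOver_of_hasGoingDown p Q
    have hmap : Ideal.map (algebraMap (MvPolynomial (Fin n) K) (Polynomial (MvPolynomial (Fin n) K))) p
      = p.map Polynomial.C := rfl
    rw [hmap] at key
    by_cases hPQ : Q = p.map Polynomial.C
    · have hp : p.height ≤ (h : ℕ∞) := le_trans (by rw [key]; exact le_self_add) hQ
      obtain ⟨t, y, hy, hn⟩ := ih θ' h hp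
      refine ⟨t + 1, Fin.cons 0 (fun i => (y i).succ), ?_, by omega⟩
      have hcons : (fun i => θ (X ((Fin.cons 0 (fun i => (y i).succ) : Fin (t+1) → Fin (n+1)) i)))
          = Fin.cons (θ (X 0)) (fun i => θ' (X (y i))) := by
        funext i
        refine Fin.cases ?_ (fun i => ?_) i <;> simp [θ']
      rw [hcons]
      refine aux_algInd_cons hy ?_
      rw [transcendental_iff]
      intro q hq
      have hlift : q.map (algebraMap _ B) ∈ Polynomial.lifts θ'.toRingHom := by
        rw [Polynomial.lifts_iff_coeff_lifts]
        intro i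
        rw [Polynomial.coeff_map]
        have h4 : Algebra.adjoin K (Set.range fun i => θ' (X (y i))) ≤ θ'.range := by
          rw [Algebra.adjoin_le_iff]
          rintro _ ⟨i, rfl⟩
          exact ⟨_, rfl⟩
        obtain ⟨z, hz⟩ := h4 (q.coeff i).2
        exact ⟨z, hz⟩
      obtain ⟨q', hq'⟩ := (Polynomial.mem_lifts _).1 hlift
      have hev : ∀ q' : Polynomial (MvPolynomial (Fin n) K),
          Θ q' = (q'.map θ'.toRingHom).eval (θ (X 0)) := by
        intro q'
        induction q' using Polynomial.induction_on' with
        | add p q hp hq => simp [hp, hq, Polynomial.map_add]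
        | monomial i a =>
          rw [Polynomial.map_monomial, Polynomial.eval_monomial,
            ← Polynomial.C_mul_X_pow_eq_monomial, map_mul, map_pow, ← hθ', ← finSuccEquiv_X_zero, hΘ]
          rfl
      have hq0 : q' ∈ Q := by
        change Θ q' = 0
        rw [hev, hq', Polynomial.eval_map_algebraMap, hq]
      rw [hPQ, Ideal.mem_map_C_iff] at hq0
      have : q.map (algebraMap _ B) = 0 := by
        rw [← hq']
        ext i
        rw [Polynomial.coeff_map]
        exact hq0 i
      exact (Polynomial.map_eq_zero_iff (FaithfulSMul.algebraMap_injective _ B)).1 this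
    · have : (p.map Polynomial.C).IsPrime := Ideal.isPrime_map_C_of_isPrime
      have h1 : 1 ≤ (Ideal.map (Ideal.Quotient.mk (p.map Polynomial.C)) Q).height := by
        rw [Order.one_le_iff_ne_zero, Ne, Ideal.height_eq_zero_iff_eq_bot]
        intro hb
        apply hPQ
        apply le_antisymm
        · rw [Ideal.map_eq_bot_iff_le_ker, Ideal.mk_ker] at hb
          exact hb
        · rw [Ideal.map_le_iff_le_comap, ← hpQ]
      cases h with
      | zero =>
        exfalso
        rw [key] at hQ
        have := le_trans (le_trans h1 le_add_self) hQ
        simp at this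
      | succ h =>
        have hp : p.height ≤ (h : ℕ∞) := by
          rw [key] at hQ
          have h2 := le_trans (add_le_add_right h1 p.height) hQ
          push_cast at h2
          exact (ENat.add_le_add_iff_right (by simp)).1 h2
        obtain ⟨t, y, hy, hn⟩ := ih θ' h hp
        refine ⟨t, fun i => (y i).succ, ?_, by omega⟩
        simpa [θ'] using hy

theorem aux_linear_forms {K : Type} [Field K] [Infinite K] {n : ℕ} {ι : Type} [Finite ι]
    (P : ι → Ideal (MvPolynomial (Fin n) K)) (hP : ∀ i, (P i).IsPrime) (c h : ℕ)
    (hc : c + h ≤ n) (hh : ∀ i, (P i).height ≤ (h : ℕ∞)) :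
    ∃ y : Fin c → (Fin n → K), ∀ i,
      AlgebraicIndependent K (fun l => Ideal.Quotient.mkₐ K (P i) (∑ t, C (y l t) * X t)) := by
  induction c with
  | zero =>
    refine ⟨Fin.elim0, fun i => ?_⟩
    have := hP i
    rw [algebraicIndependent_empty_type_iff]
    exact (algebraMap K _).injective
  | succ c ih =>
    obtain ⟨y, hy⟩ := ih (by omega)
    let L : (i : ι) → (Fin n → K) →ₗ[K] (MvPolynomial (Fin n) K ⧸ P i) := fun i =>
      (Ideal.Quotient.mkₐ K (P i)).toLinearMap ∘ₗ
        (Fintype.linearCombination K (fun t => (X t : MvPolynomial (Fin n) K)))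
    have hL : ∀ i v, L i v = Ideal.Quotient.mkₐ K (P i) (∑ t, C (v t) * X t) := by
      intro i v
      simp only [L, LinearMap.comp_apply, Fintype.linearCombination_apply, MvPolynomial.smul_eq_C_mul]
      rfl
    let A := fun i => Algebra.adjoin K (Set.range (fun l => L i (y l)))
    have hdom : ∀ i, IsDomain (MvPolynomial (Fin n) K ⧸ P i) := fun i =>
      have := hP i
      inferInstance
    let W : ι → Submodule K (Fin n → K) := fun i =>
      ((Subalgebra.algebraicClosure (A i) (MvPolynomial (Fin n) K ⧸ P i)).toSubmodule.restrictScalars K).comap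
        (L i)
    have hW : ∀ i, W i ≠ ⊤ := by
      intro i hi
      have hall : ∀ t, Ideal.Quotient.mkₐ K (P i) (X t) ∈
          Subalgebra.algebraicClosure (A i) (MvPolynomial (Fin n) K ⧸ P i) := by
        intro t
        have : Pi.single t 1 ∈ W i := by rw [hi]; trivial
        have h2 : L i (Pi.single t 1) ∈
          Subalgebra.algebraicClosure (A i) (MvPolynomial (Fin n) K ⧸ P i) := this
        simpa [L, Fintype.linearCombination_apply_single] using h2
      have halg : Algebra.IsAlgebraic (A i) (MvPolynomial (Fin n) K ⧸ P i) := by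
        constructor
        intro b
        obtain ⟨q, rfl⟩ := Ideal.Quotient.mkₐ_surjective K (P i) b
        change _ ∈ Subalgebra.algebraicClosure (A i) (MvPolynomial (Fin n) K ⧸ P i)
        induction q using MvPolynomial.induction_on with
        | C a =>
          exact ((Subalgebra.algebraicClosure (A i) (MvPolynomial (Fin n) K ⧸ P i)).restrictScalars K).algebraMap_mem a
        | add p q hp hq => rw [map_add]; exact add_mem hp hq
        | mul_X p t hp => rw [map_mul]; exact mul_mem hp (hall t)
      have h1 := Algebra.IsAlgebraic.trdeg_le_cardinalMk K (Set.range (fun l => L i (y l)))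
        (A := MvPolynomial (Fin n) K ⧸ P i)
      have h2 : Cardinal.mk (Set.range (fun l => L i (y l))) ≤ c := by
        simpa using Cardinal.mk_range_le (f := fun l => L i (y l))
      obtain ⟨t, z, hz, hn⟩ := aux_height_ker n (Ideal.Quotient.mkₐ K (P i)) h (by
        have : RingHom.ker (Ideal.Quotient.mkₐ K (P i)).toRingHom = P i := Ideal.mk_ker
        rw [this]; exact hh i)
      have h3 := hz.cardinalMk_le_trdeg
      have h4 := (h3.trans h1).trans h2
      simp at h4
      omega
    obtain ⟨v, hv⟩ : ∃ v, ∀ i, v ∉ W i := by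
      classical
      have := Fintype.ofFinite ι
      have := Subspace.biUnion_ne_univ_of_top_notMem (s := Finset.univ.image W) (by
        simpa using hW)
      rw [Ne, Set.eq_univ_iff_forall] at this
      push Not at this
      obtain ⟨v, hv⟩ := this
      refine ⟨v, fun i hi => hv ?_⟩
      simp only [Set.mem_iUnion]
      exact ⟨W i, Finset.mem_image_of_mem _ (Finset.mem_univ i), hi⟩
    refine ⟨Fin.cons v y, fun i => ?_⟩
    have h5 := hy i
    simp only [← hL] at h5 ⊢
    have h6 := aux_algInd_cons h5 (a := L i v) (fun h => hv i h)
    convert h6 using 1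
    funext l
    refine Fin.cases ?_ (fun l => ?_) l <;> simp

theorem aux_nakayama {O : Type} [CommRing O] [IsLocalRing O] {r d : ℕ}
    (g : Fin r → MvPolynomial (Fin r) O) (hg : ∀ s, (g s).totalDegree ≤ d)
    (hg' : ∀ s e, coeff e (X s ^ d - g s) ∈ IsLocalRing.maximalIdeal O)
    (p : MvPolynomial (Fin r) O) :
    ∃ c : (Fin r → Fin d) → O,
      p - ∑ a, C (c a) * ∏ s, X s ^ (a s : ℕ) ∈ Ideal.span (Set.range g) := by
  classical
  set N : Submodule O (MvPolynomial (Fin r) O) :=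
    Submodule.span O (Set.range (fun a : Fin r → Fin d => ∏ s, (X s : MvPolynomial (Fin r) O) ^ (a s : ℕ)))
      ⊔ (Ideal.span (Set.range g)).restrictScalars O with hN
  set N' := restrictTotalDegree (Fin r) O p.totalDegree with hN'
  have key : N' ≤ N ⊔ (IsLocalRing.maximalIdeal O) • N' := by
    intro q hq
    rw [hN', mem_restrictTotalDegree] at hq
    rw [q.as_sum]
    refine Submodule.sum_mem _ fun e he => ?_
    have hej : (e.sum fun _ t => t) ≤ p.totalDegree := (le_totalDegree he).trans hq
    by_cases hlt : ∀ s, e s < d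
    · refine Submodule.mem_sup_left (Submodule.mem_sup_left ?_)
      have : monomial e (coeff e q) = coeff e q • ∏ s, (X s : MvPolynomial (Fin r) O) ^ (((fun s => ⟨e s, hlt s⟩ : Fin r → Fin d)) s : ℕ) := by
        rw [monomial_eq, smul_eq_C_mul, Finsupp.prod_fintype]
        simp
      rw [this]
      exact Submodule.smul_mem _ _ (Submodule.subset_span ⟨_, rfl⟩)
    · push Not at hlt
      obtain ⟨s, hs⟩ := hlt
      have hle : Finsupp.single s d ≤ e := by
        rw [Finsupp.single_le_iff]; exact hs
      have hsplit : monomial e (coeff e q) = monomial (e - Finsupp.single s d) (coeff e q) * (X s ^ d - g s)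
          + monomial (e - Finsupp.single s d) (coeff e q) * g s := by
        rw [← mul_add, sub_add_cancel, X_pow_eq_monomial, monomial_mul, mul_one, tsub_add_cancel_of_le hle]
      rw [hsplit]
      refine Submodule.add_mem _ (Submodule.mem_sup_right ?_) (Submodule.mem_sup_left (Submodule.mem_sup_right ?_))
      · have htd : (X s ^ d - g s).totalDegree ≤ d :=
          (totalDegree_sub _ _).trans (max_le (totalDegree_X_pow s d).le (hg s))
        rw [as_sum (X s ^ d - g s), Finset.mul_sum]
        refine Submodule.sum_mem _ fun e' he' => ?_
        rw [monomial_mul]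
        have : monomial (e - Finsupp.single s d + e') (coeff e q * coeff e' (X s ^ d - g s))
          = coeff e' (X s ^ d - g s) • monomial (e - Finsupp.single s d + e') (coeff e q) := by
          rw [smul_monomial, smul_eq_mul, mul_comm]
        rw [this]
        refine Submodule.smul_mem_smul (hg' s e') ?_
        rw [hN', mem_restrictTotalDegree]
        refine (totalDegree_monomial_le _ _).trans ?_
        have h1 : (e'.sum fun _ t => t) ≤ d := (le_totalDegree he').trans htd
        have h2 : (e.sum fun _ t => t) = ((e - Finsupp.single s d).sum fun _ t => t) + d := by
          conv_lhs => rw [← tsub_add_cancel_of_le hle]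
          rw [Finsupp.sum_add_index' (by simp) (by simp)]
          simp
        show ((e - Finsupp.single s d + e').sum fun _ t => t) ≤ _
        rw [Finsupp.sum_add_index' (by simp) (by simp)]
        omega
      · exact Ideal.mul_mem_left _ _ (Ideal.subset_span ⟨s, rfl⟩)
  have hfg : N'.FG := Module.Finite.iff_fg.mp inferInstance
  have hle : N' ≤ N := Submodule.le_of_le_smul_of_le_jacobson_bot hfg
    (IsLocalRing.maximalIdeal_le_jacobson _) key
  have hp : p ∈ N := hle (by rw [hN', mem_restrictTotalDegree])
  obtain ⟨u, hu, v, hv, huv⟩ := Submodule.mem_sup.mp hp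
  obtain ⟨c, hc⟩ := (Submodule.mem_span_range_iff_exists_fun O).mp hu
  refine ⟨c, ?_⟩
  have : p - ∑ a, C (c a) * ∏ s, X s ^ (a s : ℕ) = v := by
    rw [← huv, ← hc]
    simp [smul_eq_C_mul]
  rw [this]
  exact hv

theorem aux_poly_inj {A B : Type} [CommRing A] [CommRing B] (G : Polynomial A →+* Polynomial B)
    (hX : G Polynomial.X = Polynomial.X) (G0 : A →+* B) (hG0 : Function.Injective G0)
    (h : ∀ p, (G p).coeff 0 = G0 (p.coeff 0)) : Function.Injective G := by
  rw [injective_iff_map_eq_zero]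
  have : ∀ (n : ℕ) (p : Polynomial A), p.natDegree ≤ n → G p = 0 → p = 0 := by
    intro n
    induction n with
    | zero =>
      intro p hp hGp
      have h0 : p.coeff 0 = 0 := hG0 (by rw [← h, hGp]; simp)
      rw [Polynomial.eq_C_of_natDegree_le_zero hp, h0]; simp
    | succ n ih =>
      intro p hp hGp
      have h0 : p.coeff 0 = 0 := hG0 (by rw [← h, hGp]; simp)
      have h1 : p = Polynomial.X * p.divX := by
        conv_lhs => rw [← Polynomial.X_mul_divX_add p, h0]
        simp
      have h2 : G p.divX = 0 := by
        rw [h1, map_mul, hX] at hGp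
        ext i
        have := congrArg (fun q => Polynomial.coeff q (i+1)) hGp
        simpa using this
      have h3 : p.divX = 0 := ih _ (by rw [Polynomial.natDegree_divX_eq_natDegree_tsub_one]; omega) h2
      rw [h1, h3, mul_zero]
  exact fun p hp => this _ p le_rfl hp

abbrev AuxB (F : Type) [Field F] (r m : ℕ) : Type :=
  MvPolynomial (Fin r ⊕ (Option (Fin r) × (Fin r ⊕ Fin m))) F

theorem aux_xi_inj {F : Type} [Field F] {r m d : ℕ} (hd : 1 ≤ d)
    (φ : Fin r ⊕ Fin m → MvPolynomial (Fin r) F) (hφ : ∀ s, φ (Sum.inl s) = X s ^ d)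
    (ξ : AuxB F r m →ₐ[F]
      AuxB F r m)
    (hξ1 : ∀ s, ξ (X (Sum.inl s)) = ∑ j, X (Sum.inr (some s, j)) * rename Sum.inl (φ j))
    (hξ2 : ∀ v, ξ (X (Sum.inr v)) = X (Sum.inr v)) : Function.Injective ξ := by
  classical
  let pt : Option (Fin r) × (Fin r ⊕ Fin m) → F := fun v =>
    match v with
    | (some s, Sum.inl s') => if s' = s then 1 else 0
    | _ => 0
  let a : (AuxB F r m) →ₐ[F] Polynomial (AuxB F r m) := aeval (Sum.elim (fun s => Polynomial.C (X (Sum.inl s)))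
    (fun v => Polynomial.C (C (pt v)) + Polynomial.X * Polynomial.C (X (Sum.inr v))))
  let b0 : (AuxB F r m) →ₐ[F] (AuxB F r m) := aeval (Sum.elim (fun s => X (Sum.inl s)) (fun v => X (Sum.inr v) - C (pt v)))
  let b : Polynomial (AuxB F r m) →+* (AuxB F r m) := Polynomial.eval₂RingHom b0.toRingHom 1
  have ha1 : ∀ s, a (X (Sum.inl s)) = Polynomial.C (X (Sum.inl s)) := fun s => by simp [a]
  have ha2 : ∀ v, a (X (Sum.inr v)) = Polynomial.C (C (pt v)) + Polynomial.X * Polynomial.C (X (Sum.inr v)) :=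
    fun v => by simp [a]
  have hC : ∀ c : F, algebraMap F (Polynomial (AuxB F r m)) c = Polynomial.C (C c) := fun c => rfl
  have ha0 : ∀ c : F, a (C c) = Polynomial.C (C c) := fun c => by
    rw [← hC]; exact a.commutes c
  have hba : ∀ p, b (a p) = p := by
    have : b.comp a.toRingHom = RingHom.id (AuxB F r m) := by
      refine MvPolynomial.ringHom_ext (fun c => ?_) (fun v => ?_)
      · change b (a (C c)) = C c
        rw [ha0]; simp [b, b0]
      · rcases v with s | v
        · change b (a _) = _
          rw [ha1]; simp [b, b0]
        · change b (a _) = _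
          rw [ha2]; simp [b, b0]
    exact fun p => congrArg (fun h : (AuxB F r m) →+* (AuxB F r m) => h p) this
  have hainj : Function.Injective a := Function.LeftInverse.injective hba
  let ξ1 : (AuxB F r m) →ₐ[F] Polynomial (AuxB F r m) := aeval (Sum.elim (fun s => Polynomial.C (X (Sum.inl s) ^ d) +
      Polynomial.X * Polynomial.C (∑ j, X (Sum.inr (some s, j)) * rename Sum.inl (φ j)))
      (fun v => Polynomial.C (X (Sum.inr v))))
  let ξT : Polynomial (AuxB F r m) →+* Polynomial (AuxB F r m) := Polynomial.eval₂RingHom ξ1.toRingHom Polynomial.X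
  let ξ0 : (AuxB F r m) →ₐ[F] (AuxB F r m) := aeval (Sum.elim (fun s => (X (Sum.inl s) ^ d)) (fun v => X (Sum.inr v)))
  have hξ0 : Function.Injective ξ0 := by
    let δ : (AuxB F r m) →ₐ[F] (AuxB F r m) := aeval (Sum.elim (fun s => (X (Sum.inl s))) (fun v => X (Sum.inr v) ^ d))
    have : ∀ p, δ (ξ0 p) = expand d p := by
      intro p
      have : δ.comp ξ0 = expand d := by
        refine MvPolynomial.algHom_ext fun v => ?_
        rcases v with s | v <;> simp [δ, ξ0]
      exact congrArg (fun h : (AuxB F r m) →ₐ[F] (AuxB F r m) => h p) this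
    intro p q hpq
    exact expand_injective (n := d) (by omega) (by rw [← this, ← this, hpq])
  have hξT : Function.Injective ξT := by
    refine aux_poly_inj ξT (by simp [ξT]) ξ0.toRingHom hξ0 ?_
    have : (Polynomial.constantCoeff).comp ξT = ξ0.toRingHom.comp Polynomial.constantCoeff := by
      refine Polynomial.ringHom_ext' (MvPolynomial.ringHom_ext (fun c => ?_) (fun v => ?_)) ?_
      · simp [ξT, ξ1, ξ0, hC]
      · rcases v with s | v
        · simp [ξT, ξ1, ξ0, -map_pow]
        · simp [ξT, ξ1, ξ0]
      · simp [ξT]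
    exact fun p => congrArg (fun h : Polynomial (AuxB F r m) →+* (AuxB F r m) => h p) this
  have har : ∀ q : MvPolynomial (Fin r) F, a (rename Sum.inl q) = Polynomial.C (rename Sum.inl q) := by
    intro q
    induction q using MvPolynomial.induction_on with
    | C c => simp [ha0]
    | add p q hp hq => simp [hp, hq]
    | mul_X p s hp => simp [hp, ha1]
  have hcomm : ∀ p, ξT (a p) = a (ξ p) := by
    have : ξT.comp a.toRingHom = a.toRingHom.comp ξ.toRingHom := by
      refine MvPolynomial.ringHom_ext (fun c => ?_) (fun v => ?_)
      · change ξT (a (C c)) = a (ξ (C c))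
        have : ξ (C c) = C c := ξ.commutes c
        rw [this, ha0]; simp [ξT, ξ1, hC]
      · rcases v with s | v
        · change ξT (a _) = a (ξ _)
          rw [hξ1, ha1, map_sum]
          simp only [map_mul, ha2, har]
          have hpt : ∑ j, Polynomial.C (C (pt (some s, j))) * Polynomial.C (rename Sum.inl (φ j)) =
            (Polynomial.C (X (Sum.inl s) ^ d) : Polynomial (AuxB F r m)) := by
            rw [Fintype.sum_sum_type]
            simp [pt, hφ]
          simp only [add_mul, Finset.sum_add_distrib, hpt]
          have hs : ξT (Polynomial.C (X (Sum.inl s))) = Polynomial.C (X (Sum.inl s) ^ d) +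
            Polynomial.X * Polynomial.C (∑ j, X (Sum.inr (some s, j)) * rename Sum.inl (φ j)) := by
            simp only [ξT, ξ1, Polynomial.coe_eval₂RingHom, Polynomial.eval₂_C, AlgHom.toRingHom_eq_coe,
              RingHom.coe_coe, aeval_X, Sum.elim_inl]
          rw [hs]
          congr 1
          rw [map_sum, Finset.mul_sum]
          refine Finset.sum_congr rfl fun j _ => ?_
          rw [map_mul, mul_assoc]
        · change ξT (a _) = a (ξ _)
          rw [hξ2, ha2]; simp [ξT, ξ1, hC]
    exact fun p => congrArg (fun h : (AuxB F r m) →+* Polynomial (AuxB F r m) => h p) this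
  intro p q hpq
  exact hainj (hξT (by rw [hcomm, hcomm, hpq]))

theorem aux_gauss {A : Type} [CommRing A] [IsDomain A] [UniqueFactorizationMonoid A]
    (P : Ideal (Polynomial A)) (hP : P.IsPrime) (h0 : P ≠ ⊥)
    (hc : ∀ a, Polynomial.C a ∈ P → a = 0) :
    ∃ Q, Q ≠ 0 ∧ Q ∈ P ∧ ∀ R ∈ P, Q ∣ R := by
  classical
  obtain ⟨Q, hQP, hQ⟩ := hP.exists_mem_prime_of_ne_bot h0
  have hirr := hQ.irreducible
  have hdeg : Q.natDegree ≠ 0 := by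
    intro h
    have h1 := Polynomial.eq_C_of_natDegree_le_zero h.le
    rw [h1] at hQP
    have := hc _ hQP
    rw [this] at h1
    exact hQ.ne_zero (by simpa using h1)
  have hprim := hirr.isPrimitive hdeg
  let K := FractionRing A
  have hK := (hprim.irreducible_iff_irreducible_map_fraction_map (K := K)).mp hirr
  refine ⟨Q, hQ.ne_zero, hQP, fun R hR => ?_⟩
  by_contra hndvd
  have hcop : IsCoprime (Q.map (algebraMap A K)) (R.map (algebraMap A K)) := by
    refine (hK.coprime_iff_not_dvd).mpr fun hd => hndvd ?_
    exact hprim.dvd_of_fraction_map_dvd_fraction_map hd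
  obtain ⟨u, v, huv⟩ := hcop
  obtain ⟨b, hb, hbu⟩ := IsLocalization.integerNormalization_spec (nonZeroDivisors A) u
  obtain ⟨c, hc0, hcv⟩ := IsLocalization.integerNormalization_spec (nonZeroDivisors A) v
  set u' := IsLocalization.integerNormalization (nonZeroDivisors A) u
  set v' := IsLocalization.integerNormalization (nonZeroDivisors A) v
  rw [Algebra.smul_def, Polynomial.algebraMap_apply] at hbu hcv
  have hfin : Polynomial.C (b * c) = Polynomial.C c * u' * Q + Polynomial.C b * v' * R := by
    apply Polynomial.map_injective (algebraMap A K) (IsFractionRing.injective _ _)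
    simp only [Polynomial.map_mul, Polynomial.map_add, Polynomial.map_C, hbu, hcv, map_mul]
    linear_combination (-Polynomial.C (algebraMap A K b) * Polynomial.C (algebraMap A K c)) * huv
  have hmem : Polynomial.C (b * c) ∈ P := by
    rw [hfin]
    exact P.add_mem (P.mul_mem_left _ hQP) (P.mul_mem_left _ hR)
  exact mul_ne_zero (nonZeroDivisors.ne_zero hb) (nonZeroDivisors.ne_zero hc0) (hc _ hmem)

theorem aux_gauss_mv {F σ τ : Type} [Field F] (e : Option τ ≃ σ)
    (P : Ideal (MvPolynomial σ F)) (hP : P.IsPrime) (h0 : P ≠ ⊥)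
    (hc : ∀ p : MvPolynomial τ F, rename (fun t => e (some t)) p ∈ P → p = 0) :
    ∃ Q, Q ≠ 0 ∧ Q ∈ P ∧ ∀ R ∈ P, Q ∣ R := by
  let Φ : Polynomial (MvPolynomial τ F) ≃+* MvPolynomial σ F :=
    ((optionEquivLeft F τ).symm.trans (renameEquiv F e)).toRingEquiv
  have hΦC : ∀ p, Φ (Polynomial.C p) = rename (fun t => e (some t)) p := by
    intro p
    have : ∀ q, optionEquivLeft F τ (rename some q) = Polynomial.C q := by
      intro q
      induction q using MvPolynomial.induction_on with
      | C c => simp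
      | add p q hp hq => simp [hp, hq]
      | mul_X p s hp => simp [hp]
    change renameEquiv F e ((optionEquivLeft F τ).symm (Polynomial.C p)) = _
    rw [← this p, AlgEquiv.symm_apply_apply]
    simp [rename_rename, Function.comp_def]
  obtain ⟨Q, hQ0, hQP, hQ⟩ := aux_gauss (P.comap Φ) (hP.comap _) (by
      obtain ⟨x, hx, hx0⟩ := Submodule.exists_mem_ne_zero_of_ne_bot h0
      intro h
      have : Φ.symm x ∈ P.comap Φ := by
        rw [Ideal.mem_comap, RingEquiv.apply_symm_apply]; exact hx
      rw [h, Ideal.mem_bot] at this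
      exact hx0 (by simpa using this)) (by
      intro a ha
      rw [Ideal.mem_comap, hΦC] at ha
      exact hc a ha)
  refine ⟨Φ Q, by simpa using hQ0, hQP, fun R hR => ?_⟩
  have h1 : Q ∣ Φ.symm R := hQ _ (by rw [Ideal.mem_comap, RingEquiv.apply_symm_apply]; exact hR)
  have := map_dvd Φ h1
  rwa [RingEquiv.apply_symm_apply] at this

theorem aux_wdeg_dvd {F V : Type} [Field F] (w : V → ℕ) (D : ℕ) {Q P : MvPolynomial V F}
    (hQP : Q ∣ P) (hP0 : P ≠ 0) (hP : ∀ β ∈ P.support, Finsupp.weight w β ≤ D) :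
    ∀ β ∈ Q.support, Finsupp.weight w β ≤ D := by
  classical
  let ρ : MvPolynomial V F →ₐ[F] Polynomial (MvPolynomial V F) :=
    aeval (fun v => Polynomial.C (X v) * Polynomial.X ^ (w v))
  have hmon : ∀ β c, ρ (monomial β c) = Polynomial.C (monomial β c) * Polynomial.X ^ (Finsupp.weight w β) := by
    intro β c
    simp only [ρ, aeval_monomial]
    have h1 : algebraMap F (Polynomial (MvPolynomial V F)) c = Polynomial.C (C c) := rfl
    rw [h1, monomial_eq, map_mul, mul_assoc]
    congr 1
    simp only [mul_pow, Finsupp.prod, map_prod, map_pow, Finset.prod_mul_distrib]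
    congr 1
    rw [Finsupp.weight_apply, Finsupp.sum, ← Finset.prod_pow_eq_pow_sum]
    refine Finset.prod_congr rfl fun v _ => ?_
    rw [← pow_mul, smul_eq_mul, mul_comm]
  have hcoeff : ∀ p n β, coeff β ((ρ p).coeff n) = if Finsupp.weight w β = n then coeff β p else 0 := by
    intro p n β
    induction p using MvPolynomial.induction_on' with
    | monomial γ c =>
      rw [hmon, Polynomial.coeff_C_mul, Polynomial.coeff_X_pow]
      by_cases h : γ = β
      · subst h
        by_cases h' : Finsupp.weight w γ = n
        · simp [h']
        · simp [h', Ne.symm h']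
      · split_ifs <;> simp [coeff_monomial, h]
    | add p q hp hq =>
      rw [map_add, Polynomial.coeff_add, coeff_add, hp, hq, coeff_add]
      split_ifs <;> simp
  have hinj : ∀ p, p ≠ 0 → ρ p ≠ 0 := by
    intro p hp h
    apply hp
    ext β
    have := hcoeff p (Finsupp.weight w β) β
    rw [h] at this
    simpa using this.symm
  have h1 : (ρ P).natDegree ≤ D := by
    rw [Polynomial.natDegree_le_iff_coeff_eq_zero]
    intro N hN
    ext β
    rw [hcoeff]
    split_ifs with h
    · by_contra hne
      have := hP β (by rw [mem_support_iff]; simpa using hne)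
      omega
    · simp
  have h2 : (ρ Q).natDegree ≤ (ρ P).natDegree :=
    Polynomial.natDegree_le_of_dvd (map_dvd ρ hQP) (hinj P hP0)
  intro β hβ
  refine le_trans ?_ (h2.trans h1)
  apply Polynomial.le_natDegree_of_ne_zero
  intro h
  have := hcoeff Q (Finsupp.weight w β) β
  rw [h] at this
  rw [mem_support_iff] at hβ
  exact hβ (by simpa using this.symm)

theorem aux_det_hom {R σ E : Type} [CommRing R] [Fintype E] [DecidableEq E]
    (M : Matrix E E (MvPolynomial σ R)) (hM : ∀ a b, (M a b).IsHomogeneous 1) :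
    M.det.IsHomogeneous (Fintype.card E) := by
  rw [Matrix.det_apply']
  refine IsHomogeneous.sum _ _ _ fun τ _ => ?_
  have h1 : (∏ i, M (τ i) i).IsHomogeneous (∑ _i : E, 1) :=
    IsHomogeneous.prod _ _ _ fun i _ => hM _ _
  have h2 : (((Equiv.Perm.sign τ : ℤ) : MvPolynomial σ R)).IsHomogeneous 0 := by
    have := isHomogeneous_C σ (((Equiv.Perm.sign τ : ℤ) : R))
    simpa using this
  have := h2.mul h1
  simpa using this

/-- All monomials of `p` have `w`-weight at most `D`. -/
def AuxW {F V : Type} [Field F] (w : V → ℕ) (D : ℕ) (p : MvPolynomial V F) : Prop :=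
  ∀ β ∈ p.support, Finsupp.weight w β ≤ D

theorem AuxW.add {F V : Type} [Field F] {w : V → ℕ} {D : ℕ} {p q : MvPolynomial V F}
    (hp : AuxW w D p) (hq : AuxW w D q) : AuxW w D (p + q) := by
  classical
  intro β hβ
  rcases Finset.mem_union.mp (support_add hβ) with h | h
  · exact hp β h
  · exact hq β h

theorem AuxW.sum {F V ι : Type} [Field F] {w : V → ℕ} {D : ℕ} {s : Finset ι} {p : ι → MvPolynomial V F}
    (hp : ∀ i ∈ s, AuxW w D (p i)) : AuxW w D (∑ i ∈ s, p i) := by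
  classical
  induction s using Finset.induction_on with
  | empty => intro β hβ; simp at hβ
  | insert i s hi ih =>
    rw [Finset.sum_insert hi]
    exact (hp i (by simp)).add (ih fun j hj => hp j (by simp [hj]))

theorem AuxW.mul {F V : Type} [Field F] {w : V → ℕ} {D D' : ℕ} {p q : MvPolynomial V F}
    (hp : AuxW w D p) (hq : AuxW w D' q) : AuxW w (D + D') (p * q) := by
  classical
  intro β hβ
  obtain ⟨a, ha, b, hb, rfl⟩ := Finset.mem_add.mp (support_mul p q hβ)
  rw [map_add]
  exact add_le_add (hp a ha) (hq b hb)

theorem AuxW.mono {F V : Type} [Field F] {w : V → ℕ} {D D' : ℕ} (h : D ≤ D') {p : MvPolynomial V F}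
    (hp : AuxW w D p) : AuxW w D' p := fun β hβ => (hp β hβ).trans h

theorem AuxW.of_C {F V : Type} [Field F] {w : V → ℕ} (c : F) : AuxW w 0 (C c : MvPolynomial V F) := by
  classical
  intro β hβ
  rw [mem_support_iff, coeff_C] at hβ
  have : 0 = β := by by_contra h; simp [h] at hβ
  simp [← this]

theorem AuxW.of_X {F V : Type} [Field F] {w : V → ℕ} (v : V) : AuxW w (w v) (X v : MvPolynomial V F) := by
  intro β hβ
  rw [support_X, Finset.mem_singleton] at hβ
  simp [hβ, Finsupp.weight_apply]

theorem AuxW.pow {F V : Type} [Field F] {w : V → ℕ} {D : ℕ} {p : MvPolynomial V F}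
    (hp : AuxW w D p) (n : ℕ) : AuxW w (n * D) (p ^ n) := by
  induction n with
  | zero =>
    have := AuxW.of_C (V := V) (w := w) (1 : F)
    simpa using this
  | succ n ih =>
    rw [pow_succ, Nat.succ_mul]
    exact ih.mul hp

theorem AuxW.prod {F V ι : Type} [Field F] {w : V → ℕ} {D : ι → ℕ} {s : Finset ι}
    {p : ι → MvPolynomial V F}
    (hp : ∀ i ∈ s, AuxW w (D i) (p i)) : AuxW w (∑ i ∈ s, D i) (∏ i ∈ s, p i) := by
  classical
  induction s using Finset.induction_on with
  | empty => simpa using AuxW.of_C (V := V) (w := w) (1 : F)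
  | insert i s hi ih =>
    rw [Finset.prod_insert hi, Finset.sum_insert hi]
    exact (hp i (by simp)).mul (ih fun j hj => hp j (by simp [hj]))

/-- Regroup a polynomial in the row `none` with coefficients in the other rows. -/
noncomputable def auxTau (F S J : Type) [Field F] :
    MvPolynomial J (MvPolynomial (S × J) F) →+* MvPolynomial (Option S × J) F :=
  eval₂Hom (rename (Prod.map some id)).toRingHom (fun j => X (none, j))

theorem auxTau_inj (F S J : Type) [Field F] : Function.Injective (auxTau F S J) := by
  let b : MvPolynomial (Option S × J) F →+* MvPolynomial J (MvPolynomial (S × J) F) :=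
    eval₂Hom (C.comp C) (fun v => match v with
      | (none, j) => X j
      | (some s, j) => C (X (s, j)))
  have h : b.comp (auxTau F S J) = RingHom.id _ := by
    refine MvPolynomial.ringHom_ext' (MvPolynomial.ringHom_ext (fun c => ?_) (fun v => ?_)) (fun j => ?_)
    · simp [b, auxTau]
    · obtain ⟨s, j⟩ := v
      simp [b, auxTau]
    · simp [b, auxTau]
  exact Function.LeftInverse.injective (g := b) fun p => congrArg
    (fun h : MvPolynomial J (MvPolynomial (S × J) F) →+* MvPolynomial J (MvPolynomial (S × J) F) => h p) h

theorem auxTau_weight {F S J : Type} [Field F] (w : Option S × J → ℕ)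
    (hw0 : ∀ j, w (none, j) = 1) (hw1 : ∀ s j, w (some s, j) = 0)
    (P : MvPolynomial J (MvPolynomial (S × J) F)) : AuxW w P.totalDegree (auxTau F S J P) := by
  have h0 : ∀ q : MvPolynomial (S × J) F, AuxW w 0 (rename (Prod.map some id) q) := by
    intro q
    induction q using MvPolynomial.induction_on with
    | C c => simpa using AuxW.of_C c
    | add p q hp hq => rw [map_add]; exact hp.add hq
    | mul_X p v hp =>
      rw [map_mul, rename_X]
      have := hp.mul (AuxW.of_X (F := F) (w := w) (Prod.map some id v))
      have h1 : w (Prod.map some id v) = 0 := hw1 _ _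
      rwa [h1] at this
  have hτ : auxTau F S J P = ∑ β ∈ P.support, rename (Prod.map some id) (coeff β P) *
      ∏ j ∈ β.support, X (none, j) ^ (β j) := by
    simp only [auxTau, coe_eval₂Hom]
    rw [eval₂_eq]
    rfl
  rw [hτ]
  refine AuxW.sum fun β hβ => ?_
  have h2 : AuxW w (∑ j ∈ β.support, β j * 1) (∏ j ∈ β.support, (X (none, j) : MvPolynomial (Option S × J) F) ^ (β j)) := by
    refine AuxW.prod fun j _ => AuxW.pow ?_ _
    have := AuxW.of_X (F := F) (w := w) (none, j)
    rwa [hw0] at this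
  have h3 := (h0 (coeff β P)).mul h2
  refine h3.mono ?_
  have := le_totalDegree hβ
  simpa [Finsupp.sum] using this

abbrev AuxA (F : Type) [Field F] (r m : ℕ) : Type :=
  MvPolynomial (Fin r × Option (Fin r ⊕ Fin m)) F

theorem aux_totalDegree_map {R S σ : Type} [CommRing R] [CommRing S] (f : R →+* S)
    (p : MvPolynomial σ R) : (map f p).totalDegree ≤ p.totalDegree :=
  Finset.sup_mono (support_map_subset f p)

theorem aux_detO {F : Type} [Field F] {r m d : ℕ}
    (φ : Fin r ⊕ Fin m → MvPolynomial (Fin r) F) (hφ : ∀ s, φ (Sum.inl s) = X s ^ d)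
    (hdeg : ∀ j, (φ j).totalDegree ≤ d)
    (gA : Fin r → MvPolynomial (Fin r) (AuxA F r m))
    (hgA : ∀ s, gA s = ∑ j, C (X (s, some j)) * map C (φ j) - C (X (s, none))) :
    ∃ (P : Ideal (AuxA F r m)) (_hP : P.IsPrime),
    ∃ c : (Fin r ⊕ Fin m) → (Fin r → Fin d) → (Fin r → Fin d) → Localization.AtPrime P,
      ∀ j a, map (algebraMap (AuxA F r m) (Localization.AtPrime P)) (map C (φ j)) * (∏ s, X s ^ (a s : ℕ))
        - ∑ b, C (c j a b) * ∏ s, X s ^ (b s : ℕ) ∈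
          Ideal.span (Set.range fun s => map (algebraMap (AuxA F r m) (Localization.AtPrime P)) (gA s)) := by
  classical
  let pt : Fin r × Option (Fin r ⊕ Fin m) → F := fun v =>
    match v with
    | (s, some (Sum.inl s')) => if s' = s then 1 else 0
    | _ => 0
  let ev : AuxA F r m →+* F := eval pt
  have hprime : (RingHom.ker ev).IsPrime := RingHom.ker_isPrime _
  refine ⟨RingHom.ker ev, hprime, ?_⟩
  let O := Localization.AtPrime (RingHom.ker ev)
  have h := aux_nakayama (r := r) (d := d) (O := O) (fun s => map (algebraMap (AuxA F r m) O) (gA s)) (by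
    intro s
    refine (aux_totalDegree_map _ _).trans ?_
    rw [hgA]
    refine (totalDegree_sub _ _).trans (max_le ?_ (by simp))
    refine totalDegree_finsetSum_le fun j _ => (totalDegree_mul _ _).trans ?_
    rw [totalDegree_C, zero_add]
    exact (aux_totalDegree_map _ _).trans (hdeg j)) (by
    intro s e
    have h1 : (X s ^ d - map (algebraMap (AuxA F r m) O) (gA s)) = map (algebraMap (AuxA F r m) O) (X s ^ d - gA s) := by simp
    rw [h1, coeff_map]
    rw [IsLocalization.AtPrime.to_map_mem_maximal_iff O (RingHom.ker ev), RingHom.mem_ker, ← coeff_map]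
    have h2 : map ev (X s ^ d - gA s) = 0 := by
      rw [hgA]
      simp only [map_sub, map_pow, map_X, map_sum, map_mul, map_C]
      have h3 : ∀ j, map ev (map C (φ j)) = φ j := by
        intro j
        rw [map_map]
        have : ev.comp C = RingHom.id F := by ext; simp [ev]
        rw [this, map_id]; 
      simp only [h3]
      rw [Fintype.sum_sum_type]
      simp [ev, pt, hφ]
    rw [h2]; simp)
  choose c hc using fun (j : Fin r ⊕ Fin m) (a : Fin r → Fin d) =>
    h (map (algebraMap (AuxA F r m) O) (map C (φ j)) * (∏ s, X s ^ (a s : ℕ)))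
  exact ⟨c, hc⟩

theorem aux_P0gen {F : Type} [Field F] {r m d : ℕ} (hd : 1 ≤ d)
    (P : Ideal (AuxA F r m)) (hP : P.IsPrime)
    (O L : Type) [CommRing O] [IsDomain O] [Algebra (AuxA F r m) O] [IsLocalization P.primeCompl O]
    [Field L] [Algebra (AuxB F r m) L] [IsFractionRing (AuxB F r m) L]
    (φ : Fin r ⊕ Fin m → MvPolynomial (Fin r) F) (hφ : ∀ s, φ (Sum.inl s) = X s ^ d)
    (hdeg : ∀ j, (φ j).totalDegree ≤ d)
    (ψ : MvPolynomial (Option (Fin r) × Option (Fin r ⊕ Fin m)) F →ₐ[F] AuxB F r m)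
    (hψ1 : ∀ s j, ψ (X (s, some j)) = X (Sum.inr (s, j)))
    (hψ2 : ∀ s, ψ (X (s, none)) = ∑ j, X (Sum.inr (s, j)) * rename Sum.inl (φ j))
    (hinj : Function.Injective fun p : AuxA F r m => ψ (rename (Prod.map some id) p))
    (w : Option (Fin r) × Option (Fin r ⊕ Fin m) → ℕ)
    (hw0 : ∀ j, w (none, j) = 1) (hw1 : ∀ s j, w (some s, j) = 0)
    (gA : Fin r → MvPolynomial (Fin r) (AuxA F r m))
    (hgA : ∀ s, gA s = ∑ j, C (X (s, some j)) * map C (φ j) - C (X (s, none)))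
    (c : (Fin r ⊕ Fin m) → (Fin r → Fin d) → (Fin r → Fin d) → O)
    (hc : ∀ j a, map (algebraMap (AuxA F r m) O) (map C (φ j)) * (∏ s, X s ^ (a s : ℕ))
        - ∑ b, C (c j a b) * ∏ s, X s ^ (b s : ℕ) ∈
          Ideal.span (Set.range fun s => map (algebraMap (AuxA F r m) O) (gA s))) :
    ∃ P0, P0 ≠ 0 ∧ ψ P0 = 0 ∧ AuxW w (d ^ r) P0 := by
  classical
  let alg : AuxA F r m →+* O := algebraMap (AuxA F r m) O
  have halg : Function.Injective alg := IsLocalization.injective O (Ideal.primeCompl_le_nonZeroDivisors P)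
  -- the determinant
  let Mx : Matrix (Fin r → Fin d) (Fin r → Fin d) (MvPolynomial (Option (Fin r ⊕ Fin m)) O) :=
    fun a b => ∑ j, X (some j) * C (c j a b) - if a = b then X none else 0
  have hMx : ∀ a b, (Mx a b).IsHomogeneous 1 := by
    intro a b
    refine IsHomogeneous.sub (IsHomogeneous.sum _ _ _ fun j _ => ?_) ?_
    · simpa using (isHomogeneous_X O (some j)).mul (isHomogeneous_C _ (c j a b))
    · split_ifs
      · exact isHomogeneous_X _ _
      · exact isHomogeneous_zero _ _ _
  have hDdeg : Mx.det.totalDegree ≤ d ^ r := by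
    have := (aux_det_hom Mx hMx).totalDegree_le
    simpa using this
  have hD0 : Mx.det ≠ 0 := by
    intro h
    let ev : MvPolynomial (Option (Fin r ⊕ Fin m)) O →+* O :=
      eval (fun j => match j with | none => -1 | some _ => 0)
    have h1 : ev.mapMatrix Mx = 1 := by
      ext a b
      change ev (∑ j, X (some j) * C (c j a b) - if a = b then X none else 0) = _
      rw [Matrix.one_apply]
      simp only [ev]
      split_ifs <;> simp
    have h2 := RingHom.map_det ev Mx
    rw [h1, h, Matrix.det_one, map_zero] at h2
    exact zero_ne_one h2
  -- clear denominators
  let _ : Algebra (MvPolynomial (Option (Fin r ⊕ Fin m)) (AuxA F r m))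
      (MvPolynomial (Option (Fin r ⊕ Fin m)) O) := MvPolynomial.algebraMvPolynomial
  obtain ⟨⟨P1, c1⟩, hPc⟩ := IsLocalization.surj (R := MvPolynomial (Option (Fin r ⊕ Fin m)) (AuxA F r m))
    (Submonoid.map C P.primeCompl)
    (S := MvPolynomial (Option (Fin r ⊕ Fin m)) O) Mx.det
  obtain ⟨c1, c0, hc0, rfl⟩ := c1
  have hc0' : c0 ≠ 0 := fun h => hc0 (h ▸ P.zero_mem)
  have hPc : Mx.det * C (alg c0) = map alg P1 := by
    have h1 : ∀ q, algebraMap (MvPolynomial (Option (Fin r ⊕ Fin m)) (AuxA F r m)) 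
      (MvPolynomial (Option (Fin r ⊕ Fin m)) O) q = map alg q := fun q => rfl
    simpa [h1] using hPc
  have hac : alg c0 ≠ 0 := fun h => hc0' (halg (by rw [h, map_zero]))
  have hP1 : P1 ≠ 0 := by
    intro h
    rw [h, map_zero] at hPc
    exact mul_ne_zero hD0 (by simpa using hac) hPc
  have hP1d : P1.totalDegree ≤ d ^ r := by
    have h1 : (map alg P1).totalDegree ≤ d ^ r := by
      rw [← hPc]
      refine (totalDegree_mul _ _).trans ?_
      simpa using hDdeg
    refine le_trans ?_ h1
    refine Finset.sup_le fun β hβ => ?_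
    refine le_totalDegree (p := map alg P1) ?_
    rw [mem_support_iff, coeff_map]
    rw [mem_support_iff] at hβ
    exact fun h => hβ (halg (by rw [h, map_zero]))
  refine ⟨auxTau F (Fin r) (Option (Fin r ⊕ Fin m)) P1, ?_, ?_, ?_⟩
  · intro h
    exact hP1 (auxTau_inj F _ _ (by rw [h, map_zero]))
  swap
  · exact (auxTau_weight w hw0 hw1 P1).mono hP1d
  -- vanishing
  let iB : AuxB F r m →+* L := algebraMap _ L
  have hiB : Function.Injective iB := IsFractionRing.injective _ _
  let lam : AuxA F r m →+* L := (iB.comp ψ.toRingHom).comp (rename (Prod.map some id)).toRingHom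
  have hlam : ∀ p, lam p = iB (ψ (rename (Prod.map some id) p)) := fun p => rfl
  have hlaminj : Function.Injective lam := hiB.comp hinj
  have hunit : ∀ y : P.primeCompl, IsUnit (lam y) := by
    intro y
    refine IsUnit.mk0 _ fun h => ?_
    have : (y : AuxA F r m) = 0 := hlaminj (by rw [h, map_zero])
    exact y.2 (this ▸ P.zero_mem)
  let lamO : O →+* L := IsLocalization.lift (M := P.primeCompl) hunit
  have hlamO : ∀ x, lamO (alg x) = lam x := fun x => IsLocalization.lift_eq hunit x
  let lam1 : MvPolynomial (Option (Fin r ⊕ Fin m)) O →+* L := eval₂Hom lamO (fun j => iB (ψ (X (none, j))))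
  have hlam1 : ∀ q, iB (ψ (auxTau F (Fin r) (Option (Fin r ⊕ Fin m)) q)) = lam1 (map alg q) := by
    intro q
    induction q using MvPolynomial.induction_on with
    | C p =>
      simp only [lam1, auxTau, coe_eval₂Hom, eval₂_C, map_C, hlamO, hlam]
      rfl
    | add p q hp hq => simp only [map_add, hp, hq]
    | mul_X p v hp => 
      rw [map_mul, map_mul, map_mul, map_mul, map_mul, hp]
      simp [lam1, auxTau]
  apply hiB
  rw [hlam1, ← hPc, map_mul, map_zero]
  suffices h : lam1 Mx.det = 0 by rw [h, zero_mul]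
  let κ : MvPolynomial (Fin r) O →+* L := eval₂Hom lamO (fun s => iB (X (Sum.inl s)))
  have hκφ : ∀ q : MvPolynomial (Fin r) F, κ (map alg (map C q)) = iB (rename Sum.inl q) := by
    intro q
    induction q using MvPolynomial.induction_on with
    | C p =>
      simp only [κ, coe_eval₂Hom, eval₂_C, map_C, hlamO, hlam, rename_C]
      congr 1
      exact ψ.commutes p
    | add p q hp hq => simp only [map_add, hp, hq]
    | mul_X p v hp =>
      rw [map_mul, map_mul, map_mul, hp]
      simp [κ]
  have hlX1 : ∀ s j, lam (X (s, some j)) = iB (X (Sum.inr (some s, j))) := by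
    intro s j
    rw [hlam, rename_X, Prod.map_apply, id, hψ1]
  have hlX2 : ∀ s, lam (X (s, none)) = ∑ j, iB (X (Sum.inr (some s, j))) * iB (rename Sum.inl (φ j)) := by
    intro s
    rw [hlam, rename_X, Prod.map_apply, id, hψ2, map_sum]
    simp only [map_mul]
  have hκC : ∀ x, κ (C x) = lamO x := fun x => by simp [κ]
  have hκg : ∀ s, κ (map alg (gA s)) = 0 := by
    intro s
    simp only [hgA, map_sub, map_sum, map_mul, hκφ, map_C, hκC, hlamO, hlX1, hlX2, sub_self]
  have hκspan : ∀ q ∈ Ideal.span (Set.range fun s => map alg (gA s)), κ q = 0 := by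
    intro q hq
    have : Ideal.span (Set.range fun s => map alg (gA s)) ≤ RingHom.ker κ := by
      rw [Ideal.span_le]
      rintro _ ⟨s, rfl⟩
      exact hκg s
    exact this hq
  let z : (Fin r → Fin d) → L := fun b => κ (∏ s, X s ^ (b s : ℕ))
  have hcz : ∀ j a, ∑ b, lamO (c j a b) * z b = iB (rename Sum.inl (φ j)) * z a := by
    intro j a
    have := hκspan _ (hc j a)
    rw [map_sub, map_mul, map_sum] at this
    simp only [map_mul] at this
    have h2 := hκφ (φ j)
    simp only [hκC] at this
    rw [sub_eq_zero] at this
    rw [← h2]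
    exact this.symm
  rw [RingHom.map_det]
  rw [← Matrix.exists_mulVec_eq_zero_iff]
  refine ⟨z, ?_, ?_⟩
  · intro h
    have := congrFun h (fun _ => ⟨0, by omega⟩)
    simp [z] at this
  · ext a
    rw [Matrix.mulVec, dotProduct]
    have hent : ∀ b, (lam1.mapMatrix Mx) a b = ∑ j, iB (X (Sum.inr (none, j))) * lamO (c j a b)
        - if a = b then ∑ j, iB (X (Sum.inr (none, j))) * iB (rename Sum.inl (φ j)) else 0 := by
      intro b
      change lam1 (∑ j, X (some j) * C (c j a b) - if a = b then X none else 0) = _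
      simp only [map_sub, map_sum, map_mul]
      congr 1
      · refine Finset.sum_congr rfl fun j _ => ?_
        simp [lam1, hψ1]
      · split_ifs
        · simp [lam1, hψ2]
        · simp
    simp only [hent, sub_mul, Finset.sum_sub_distrib, ite_mul, zero_mul, Finset.sum_ite_eq, 
      Finset.mem_univ, if_true, Pi.zero_apply]
    rw [sub_eq_zero]
    simp only [Finset.sum_mul, mul_assoc]
    rw [Finset.sum_comm]
    refine Finset.sum_congr rfl fun j _ => ?_
    rw [← Finset.mul_sum, hcz]


theorem aux_P0 {F : Type} [Field F] {r m d : ℕ} (hd : 1 ≤ d)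
    (φ : Fin r ⊕ Fin m → MvPolynomial (Fin r) F) (hφ : ∀ s, φ (Sum.inl s) = X s ^ d)
    (hdeg : ∀ j, (φ j).totalDegree ≤ d)
    (ψ : MvPolynomial (Option (Fin r) × Option (Fin r ⊕ Fin m)) F →ₐ[F] AuxB F r m)
    (hψ1 : ∀ s j, ψ (X (s, some j)) = X (Sum.inr (s, j)))
    (hψ2 : ∀ s, ψ (X (s, none)) = ∑ j, X (Sum.inr (s, j)) * rename Sum.inl (φ j))
    (hinj : Function.Injective fun p : AuxA F r m => ψ (rename (Prod.map some id) p))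
    (w : Option (Fin r) × Option (Fin r ⊕ Fin m) → ℕ)
    (hw0 : ∀ j, w (none, j) = 1) (hw1 : ∀ s j, w (some s, j) = 0) :
    ∃ P0, P0 ≠ 0 ∧ ψ P0 = 0 ∧ AuxW w (d ^ r) P0 := by
  obtain ⟨P, hP, c, hc⟩ := aux_detO φ hφ hdeg
    (fun s => ∑ j, C (X (s, some j)) * map C (φ j) - C (X (s, none))) (fun s => rfl)
  exact aux_P0gen hd P hP (Localization.AtPrime P) (FractionRing (AuxB F r m)) φ hφ hdeg ψ hψ1 hψ2 hinj w hw0 hw1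
    _ (fun s => rfl) c hc

theorem aux_L3 {F : Type} [Field F] {r m d : ℕ} (hd : 1 ≤ d)
    (φ : Fin r ⊕ Fin m → MvPolynomial (Fin r) F) (hφ : ∀ s, φ (Sum.inl s) = X s ^ d)
    (hdeg : ∀ j, (φ j).totalDegree ≤ d) :
    ∃ Q : MvPolynomial (Option (Fin r) × Option (Fin r ⊕ Fin m)) F, Q ≠ 0 ∧
      Q.totalDegree ≤ (r + 1) * d ^ r ∧
      ∀ (Ω : Type) [CommRing Ω] [Algebra F Ω] (z0 : Fin r → Ω)
        (Λ0 : Option (Fin r) × Option (Fin r ⊕ Fin m) → Ω),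
        (∀ s, Λ0 (s, none) = ∑ j, Λ0 (s, some j) * aeval z0 (φ j)) → aeval Λ0 Q = 0 := by
  classical
  let ψ : MvPolynomial (Option (Fin r) × Option (Fin r ⊕ Fin m)) F →ₐ[F] AuxB F r m :=
    aeval (fun v => match v with
      | (s, some j) => X (Sum.inr (s, j))
      | (s, none) => ∑ j, X (Sum.inr (s, j)) * rename Sum.inl (φ j))
  have hψ1 : ∀ s j, ψ (X (s, some j)) = X (Sum.inr (s, j)) := fun s j => by simp [ψ]
  have hψ2 : ∀ s, ψ (X (s, none)) = ∑ j, X (Sum.inr (s, j)) * rename Sum.inl (φ j) :=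
    fun s => by rw [aeval_X]
  let e : Option (Fin r ⊕ (Option (Fin r) × (Fin r ⊕ Fin m))) ≃
      Option (Fin r) × Option (Fin r ⊕ Fin m) :=
    { toFun := fun u => match u with
        | none => (none, none)
        | some (Sum.inl s) => (some s, none)
        | some (Sum.inr (s, j)) => (s, some j)
      invFun := fun v => match v with
        | (none, none) => none
        | (some s, none) => some (Sum.inl s)
        | (s, some j) => some (Sum.inr (s, j))
      left_inv := by rintro (_ | (s | ⟨(_ | s), j⟩)) <;> rfl
      right_inv := by rintro ⟨(_ | s), (_ | j)⟩ <;> rfl }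
  have he1 : ∀ s, e (some (Sum.inl s)) = (some s, none) := fun s => rfl
  have he2 : ∀ s j, e (some (Sum.inr (s, j))) = (s, some j) := fun s j => rfl
  let ξ : AuxB F r m →ₐ[F] AuxB F r m := ψ.comp (rename (fun t => e (some t)))
  have hξ : Function.Injective ξ := by
    refine aux_xi_inj hd φ hφ ξ (fun s => ?_) (fun v => ?_)
    · simp only [ξ, AlgHom.comp_apply, rename_X, he1, hψ2]
    · obtain ⟨s, j⟩ := v
      simp only [ξ, AlgHom.comp_apply, rename_X, he2, hψ1]
  have hinj : Function.Injective fun p : AuxA F r m => ψ (rename (Prod.map some id) p) := by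
    let κ : Fin r × Option (Fin r ⊕ Fin m) → Fin r ⊕ (Option (Fin r) × (Fin r ⊕ Fin m)) :=
      fun v => match v with
      | (s, none) => Sum.inl s
      | (s, some j) => Sum.inr (some s, j)
    have hκ : Function.Injective κ := by
      rintro ⟨s, (_ | j)⟩ ⟨s', (_ | j')⟩ h <;> simp_all [κ]
    have h1 : ∀ p : AuxA F r m, ψ (rename (Prod.map some id) p) = ξ (rename κ p) := by
      intro p
      simp only [ξ, AlgHom.comp_apply, rename_rename]
      congr 2
      congr 1
      ext1 ⟨s, j⟩
      cases j <;> rfl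
    intro p q h
    simp only [h1] at h
    exact rename_injective _ hκ (hξ h)
  let w : Option (Fin r) → Option (Fin r) × Option (Fin r ⊕ Fin m) → ℕ :=
    fun s v => if v.1 = s then 1 else 0
  obtain ⟨P0, hP0, hψP0, hw⟩ := aux_P0 hd φ hφ hdeg ψ hψ1 hψ2 hinj (w none)
    (fun j => by simp [w]) (fun s j => by simp [w])
  have hprime : (RingHom.ker ψ).IsPrime := RingHom.ker_isPrime _
  obtain ⟨Q, hQ0, hQ, hdvd⟩ := aux_gauss_mv e (RingHom.ker ψ) hprime
    (fun h => hP0 (by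
      have : P0 ∈ RingHom.ker ψ := hψP0
      rw [h] at this
      simpa using this))
    (fun p hp => hξ (by rw [map_zero]; exact hp))
  have hrow : ∀ s, ∀ β ∈ Q.support, Finsupp.weight (w s) β ≤ d ^ r := by
    intro s
    let π := Equiv.swap none s
    have hπ : Function.Injective (Prod.map π (id : Option (Fin r ⊕ Fin m) → _)) :=
      Function.Injective.prodMap π.injective Function.injective_id
    let χ : AuxB F r m →ₐ[F] AuxB F r m := rename (Sum.map id (Prod.map π id))
    have hχ : ∀ p, ψ (rename (Prod.map π id) p) = χ (ψ p) := by
      intro p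
      have : ψ.comp (rename (Prod.map π id)) = χ.comp ψ := by
        refine algHom_ext fun v => ?_
        obtain ⟨s', (_ | j)⟩ := v
        · simp only [AlgHom.comp_apply, rename_X, Prod.map_apply, id, hψ2, map_sum, map_mul]
          refine Finset.sum_congr rfl fun j _ => ?_
          simp only [χ, rename_X, rename_rename]
          rfl
        · simp only [AlgHom.comp_apply, rename_X, Prod.map_apply, id, hψ1, χ]
          rfl
      exact DFunLike.congr_fun this p
    refine aux_wdeg_dvd (w s) (d ^ r) (hdvd (rename (Prod.map π id) P0) ?_) ?_ ?_
    · rw [RingHom.mem_ker, hχ, hψP0, map_zero]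
    · intro h
      exact hP0 (rename_injective _ hπ (by rw [h, map_zero]))
    · intro β hβ
      rw [support_rename_of_injective hπ, Finset.mem_image] at hβ
      obtain ⟨γ, hγ, rfl⟩ := hβ
      refine le_trans (le_of_eq ?_) (hw γ hγ)
      rw [Finsupp.weight_apply, Finsupp.weight_apply, Finsupp.sum_mapDomain_index_inj hπ]
      refine Finsupp.sum_congr fun v _ => ?_
      have : w s (Prod.map π id v) = w none v := by
        simp only [w, Prod.map_fst, π]
        congr 1
        rw [Equiv.swap_apply_eq_iff, Equiv.swap_apply_right]
      rw [this]
  refine ⟨Q, hQ0, ?_, ?_⟩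
  · refine Finset.sup_le fun β hβ => ?_
    have h1 : (β.sum fun _ e => e) = ∑ s, Finsupp.weight (w s) β := by
      simp only [Finsupp.weight_apply, Finsupp.sum]
      rw [Finset.sum_comm]
      refine Finset.sum_congr rfl fun v _ => ?_
      simp [w]
    rw [h1]
    refine (Finset.sum_le_sum fun s _ => hrow s β hβ).trans ?_
    simp
  · intro Ω _ _ z0 Λ0 hΛ
    let ev : AuxB F r m →ₐ[F] Ω := aeval (Sum.elim z0 (fun v => Λ0 (v.1, some v.2)))
    have : aeval Λ0 = ev.comp ψ := by
      refine algHom_ext fun v => ?_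
      obtain ⟨s, (_ | j)⟩ := v
      · rw [aeval_X, AlgHom.comp_apply, hψ2, hΛ, map_sum]
        refine Finset.sum_congr rfl fun j _ => ?_
        simp only [ev, map_mul, aeval_X, aeval_rename]
        rfl
      · rw [aeval_X, AlgHom.comp_apply, hψ1, aeval_X]
        rfl
    rw [this, AlgHom.comp_apply, show ψ Q = 0 from hQ, map_zero]

theorem aux_sum_deg {R S T : Type} [Field R] [Fintype S] [Fintype T] (p : MvPolynomial (S ⊕ T) R)
    (α : S →₀ ℕ) : (coeff α (sumAlgEquiv R S T p)).totalDegree ≤ p.totalDegree := by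
  classical
  have hmon : ∀ (u : S ⊕ T →₀ ℕ) (a : R), sumAlgEquiv R S T (monomial u a) =
      monomial (Finsupp.sumFinsuppAddEquivProdFinsupp u).1
        (monomial (Finsupp.sumFinsuppAddEquivProdFinsupp u).2 a) := by
    intro u a
    simp [sumAlgEquiv, monomial]
  have h : sumAlgEquiv R S T p = ∑ u ∈ p.support, monomial (Finsupp.sumFinsuppAddEquivProdFinsupp u).1
        (monomial (Finsupp.sumFinsuppAddEquivProdFinsupp u).2 (coeff u p)) := by
    conv_lhs => rw [p.as_sum]
    rw [map_sum]
    exact Finset.sum_congr rfl fun u _ => hmon _ _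
  rw [h, coeff_sum]
  refine totalDegree_finsetSum_le fun u hu => ?_
  rw [coeff_monomial]
  split_ifs
  · refine (totalDegree_monomial_le _ _).trans (le_trans ?_ (le_totalDegree hu))
    rw [Finsupp.sum_fintype _ _ (fun _ => rfl), Finsupp.sum_fintype _ _ (fun _ => rfl),
      Fintype.sum_sum_type]
    have : ∀ t, (Finsupp.sumFinsuppAddEquivProdFinsupp u).2 t = u (Sum.inr t) := fun t => rfl
    simp only [this]
    exact Nat.le_add_left _ _
  · simp

theorem aux_L4 {F : Type} [Field F] {r m d : ℕ} (hd : 1 ≤ d)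
    (f : Fin m → MvPolynomial (Fin r) F) (hf : ∀ j, (f j).totalDegree ≤ d) :
    ∃ H : MvPolynomial (Option (Fin r) × Fin m) F, H ≠ 0 ∧
      H.totalDegree ≤ (r + 1) * d ^ r ∧
      ∀ (Ω : Type) [Field Ω] [Algebra F Ω] (z0 : Fin r → Ω)
        (Λ0 : Option (Fin r) × Fin m → Ω) (j1 : Fin m),
        (∀ s, ∑ j, Λ0 (s, j) * aeval z0 (f j) = 0) → aeval z0 (f j1) ≠ 0 → aeval Λ0 H = 0 := by
  classical
  obtain ⟨Q, hQ0, hQd, hQ⟩ := aux_L3 (r := r) (m := m) hd (Sum.elim (fun s => X s ^ d) f) (fun s => rfl)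
    (by rintro (s | j)
        · simp
        · exact hf j)
  let e : Option (Fin r) × Option (Fin r ⊕ Fin m) ≃
      (Option (Fin r) × Option (Fin r)) ⊕ (Option (Fin r) × Fin m) :=
    { toFun := fun v => match v with
        | (s, none) => Sum.inl (s, none)
        | (s, some (Sum.inl s')) => Sum.inl (s, some s')
        | (s, some (Sum.inr j)) => Sum.inr (s, j)
      invFun := fun v => match v with
        | Sum.inl (s, none) => (s, none)
        | Sum.inl (s, some s') => (s, some (Sum.inl s'))
        | Sum.inr (s, j) => (s, some (Sum.inr j))
      left_inv := by rintro ⟨s, (_ | (s' | j))⟩ <;> rfl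
      right_inv := by rintro (⟨s, (_ | s')⟩ | ⟨s, j⟩) <;> rfl }
  let Q' := sumAlgEquiv F (Option (Fin r) × Option (Fin r)) (Option (Fin r) × Fin m) (rename e Q)
  have hQ'0 : Q' ≠ 0 := by
    intro h
    have h1 : rename e Q = 0 := (sumAlgEquiv F _ _).injective (by rw [map_zero]; exact h)
    exact hQ0 (rename_injective _ e.injective (by rw [h1, map_zero]))
  obtain ⟨α0, hα0, hmin⟩ := Finset.exists_min_image Q'.support (fun α => Finsupp.degree α)
    (by rwa [Finset.nonempty_iff_ne_empty, Ne, support_eq_empty])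
  refine ⟨coeff α0 Q', by rwa [mem_support_iff] at hα0, ?_, ?_⟩
  · refine (aux_sum_deg _ _).trans (le_trans ?_ hQd)
    exact totalDegree_rename_le _ _
  intro Ω _ _ z0 Λ0 j1 hΛ hj1
  -- generic evaluation
  let lin : Option (Fin r) → MvPolynomial (Option (Fin r) × Option (Fin r)) Ω := fun s =>
    (X (s, none) - ∑ s', X (s, some s') * C (z0 s' ^ d)) * C ((aeval z0 (f j1))⁻¹)
  let ΛT : Option (Fin r) × Fin m → MvPolynomial (Option (Fin r) × Option (Fin r)) Ω := fun v =>
    C (Λ0 v) + if v.2 = j1 then lin v.1 else 0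
  let Λ1 : Option (Fin r) × Option (Fin r ⊕ Fin m) →
      MvPolynomial (Option (Fin r) × Option (Fin r)) Ω := fun v => Sum.elim X ΛT (e v)
  have hC : ∀ q : MvPolynomial (Fin r) F, aeval (fun s => (C (z0 s) :
      MvPolynomial (Option (Fin r) × Option (Fin r)) Ω)) q = C (aeval z0 q) := by
    intro q
    induction q using MvPolynomial.induction_on with
    | C a => simp [algebraMap_eq, IsScalarTower.algebraMap_apply F Ω (MvPolynomial _ Ω)]
    | add p q hp hq => simp only [map_add, hp, hq]
    | mul_X p v hp => simp only [map_mul, hp, aeval_X]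
  have hvan : aeval Λ1 Q = 0 := by
    refine hQ _ (fun s => C (z0 s)) Λ1 fun s => ?_
    rw [Fintype.sum_sum_type]
    have h1 : Λ1 (s, none) = X (s, none) := rfl
    have h2 : ∀ s', Λ1 (s, some (Sum.inl s')) = X (s, some s') := fun s' => rfl
    have h3 : ∀ j, Λ1 (s, some (Sum.inr j)) = C (Λ0 (s, j)) + if j = j1 then lin s else 0 :=
      fun j => rfl
    simp only [h1, h2, h3, Sum.elim_inl, Sum.elim_inr, hC, add_mul, Finset.sum_add_distrib,
      ite_mul, zero_mul, Finset.sum_ite_eq', Finset.mem_univ, if_true, ← C_mul, ← map_sum, hΛ,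
      map_pow, aeval_X, map_zero, zero_add]
    simp only [lin]
    rw [mul_assoc, ← C_mul, inv_mul_cancel₀ hj1]
    simp
  let g : MvPolynomial (Option (Fin r) × Fin m) F →+*
    MvPolynomial (Option (Fin r) × Option (Fin r)) Ω := (aeval ΛT).toRingHom
  have hev : aeval Λ1 Q = eval₂ g X Q' := by
    have : ∀ p : MvPolynomial ((Option (Fin r) × Option (Fin r)) ⊕ (Option (Fin r) × Fin m)) F,
        aeval (Sum.elim X ΛT) p = eval₂ g X (sumAlgEquiv F _ _ p) := by
      intro p
      induction p using MvPolynomial.induction_on with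
      | C a => simp [g]
      | add p q hp hq => simp only [map_add, hp, hq, eval₂_add]
      | mul_X p v hp =>
        simp only [map_mul, hp, aeval_X, eval₂_mul]
        congr 1
        cases v <;> simp [g]
    rw [← this, aeval_rename]
    rfl
  have hcc : ∀ q, constantCoeff (g q) = aeval Λ0 q := by
    intro q
    induction q using MvPolynomial.induction_on with
    | C a => simp [g, IsScalarTower.algebraMap_apply F Ω (MvPolynomial _ Ω), algebraMap_eq]
    | add p q hp hq => simp only [map_add, hp, hq]
    | mul_X p v hp =>
      simp only [map_mul, hp, aeval_X]
      congr 1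
      simp only [g, AlgHom.toRingHom_eq_coe, RingHom.coe_coe, aeval_X, ΛT, map_add, constantCoeff_C]
      split_ifs <;> simp [lin]
  have hco : coeff α0 (eval₂ g X Q') = aeval Λ0 (coeff α0 Q') := by
    rw [eval₂_eq, coeff_sum]
    rw [Finset.sum_eq_single α0]
    · have : (∏ i ∈ α0.support, (X i : MvPolynomial (Option (Fin r) × Option (Fin r)) Ω) ^ α0 i) = monomial α0 1 := by
        rw [monomial_eq, C_1, one_mul]; rfl
      rw [this, coeff_mul_monomial', if_pos le_rfl, tsub_self, mul_one, ← hcc]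
      rfl
    · intro α hα hne
      have : (∏ i ∈ α.support, (X i : MvPolynomial (Option (Fin r) × Option (Fin r)) Ω) ^ α i) = monomial α 1 := by
        rw [monomial_eq, C_1, one_mul]; rfl
      rw [this, coeff_mul_monomial', if_neg]
      intro hle
      apply hne
      have h1 := hmin α hα
      obtain ⟨γ, rfl⟩ := exists_add_of_le hle
      simp only [map_add] at h1
      have : γ.degree = 0 := by omega
      rw [Finsupp.degree_eq_zero_iff] at this
      rw [this, add_zero]
    · intro h; exact absurd hα0 h
  rw [← hco, ← hev, hvan, coeff_zero]

theorem aux_functional {K F σ : Type} [Field K] [Field F] [Algebra K F] (HF : MvPolynomial σ F)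
    (h0 : HF ≠ 0) : ∃ H : MvPolynomial σ K, H ≠ 0 ∧ H.totalDegree ≤ HF.totalDegree ∧
      ∀ Λ : σ → K, eval (fun v => algebraMap K F (Λ v)) HF = 0 → eval Λ H = 0 := by
  classical
  obtain ⟨β0, hβ0⟩ := MvPolynomial.ne_zero_iff.mp h0
  obtain ⟨l, hl⟩ : ∃ l : Module.Dual K F, l (coeff β0 HF) ≠ 0 := by
    by_contra! h
    exact hβ0 ((Module.forall_dual_apply_eq_zero_iff K _).mp h)
  have hco : ∀ β, coeff β (∑ γ ∈ HF.support, monomial γ (l (coeff γ HF))) = l (coeff β HF) := by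
    intro β
    simp only [coeff_sum, coeff_monomial, Finset.sum_ite_eq', mem_support_iff]
    split_ifs with h
    · rfl
    · rw [not_not] at h
      rw [h, map_zero]
  refine ⟨∑ β ∈ HF.support, monomial β (l (coeff β HF)), ?_, ?_, ?_⟩
  · intro h
    apply hl
    rw [← hco, h, coeff_zero]
  · refine totalDegree_finsetSum_le fun β hβ => ?_
    exact (totalDegree_monomial_le _ _).trans (le_totalDegree hβ)
  · intro Λ hΛ
    rw [eval_eq] at hΛ
    have h1 := congrArg l hΛ
    rw [map_zero, map_sum] at h1
    rw [map_sum, ← h1]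
    refine Finset.sum_congr rfl fun β _ => ?_
    rw [eval_monomial]
    have : coeff β HF * ∏ i ∈ β.support, (algebraMap K F (Λ i)) ^ β i =
        (∏ i ∈ β.support, Λ i ^ β i) • coeff β HF := by
      rw [Algebra.smul_def, map_prod, mul_comm]
      simp only [map_pow]
    rw [this, map_smul, smul_eq_mul, mul_comm]
    rfl

theorem aux_subst_deg {K F σ τ : Type} [CommRing K] [Field F] [Algebra K F]
    (x : σ → MvPolynomial τ F) (hx : ∀ t, (x t).totalDegree ≤ 1) (p : MvPolynomial σ K) :
    (aeval x p).totalDegree ≤ p.totalDegree := by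
  rw [aeval_def, eval₂_eq]
  refine totalDegree_finsetSum_le fun β hβ => ?_
  refine (totalDegree_mul _ _).trans (le_trans ?_ (le_totalDegree hβ))
  rw [IsScalarTower.algebraMap_apply K F (MvPolynomial τ F), algebraMap_eq, totalDegree_C, zero_add]
  refine (totalDegree_finsetProd _ _).trans (Finset.sum_le_sum fun i _ => ?_)
  refine (totalDegree_pow _ _).trans ?_
  simpa using Nat.mul_le_mul_left (β i) (hx i)

theorem aux_finite_red {K σ : Type} [Field K] [Finite σ] (D : ℕ) (B : Set (σ → K))
    (h : ∀ B0 : Finset (σ → K), (B0 : Set (σ → K)) ⊆ B →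
      ∃ H : MvPolynomial σ K, H ≠ 0 ∧ H.totalDegree ≤ D ∧ ∀ b ∈ B0, eval b H = 0) :
    ∃ H : MvPolynomial σ K, H ≠ 0 ∧ H.totalDegree ≤ D ∧ ∀ b ∈ B, eval b H = 0 := by
  classical
  let Z : Finset (σ → K) → Submodule K (restrictTotalDegree σ K D) := fun S =>
    { carrier := {H | ∀ b ∈ S, eval b (H : MvPolynomial σ K) = 0}
      add_mem' := fun {p q} hp hq b hb => by simp [hp b hb, hq b hb]
      zero_mem' := fun b _ => by simp
      smul_mem' := fun c p hp b hb => by simp [hp b hb] }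
  have hZ : ∀ S H, H ∈ Z S ↔ ∀ b ∈ S, eval b (H : MvPolynomial σ K) = 0 := fun S H => Iff.rfl
  obtain ⟨_, ⟨S0, hS0, rfl⟩, hmin⟩ := WellFounded.has_min
    (wellFounded_lt (α := Submodule K (restrictTotalDegree σ K D)))
    (Z '' {S | (S : Set (σ → K)) ⊆ B}) ⟨_, ∅, by simp, rfl⟩
  obtain ⟨H, hH0, hHd, hH⟩ := h S0 hS0
  refine ⟨H, hH0, hHd, fun b hb => ?_⟩
  by_contra hne
  refine hmin (Z (insert b S0)) ⟨_, ?_, rfl⟩ ?_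
  · simp only [Set.mem_ofPred_eq, Finset.coe_insert]
    exact Set.insert_subset hb hS0
  · refine lt_of_le_of_ne (fun p hp => ?_) (fun heq => ?_)
    · rw [hZ] at hp ⊢
      exact fun b' hb' => hp b' (Finset.mem_insert_of_mem hb')
    · have h1 : (⟨H, (mem_restrictTotalDegree _ _ _).mpr hHd⟩ : restrictTotalDegree σ K D) ∈ Z S0 :=
        (hZ _ _).mpr hH
      rw [← heq, hZ] at h1
      exact hne (h1 b (Finset.mem_insert_self _ _))

theorem aux_complete {K : Type} [Field K] {M c r : ℕ} (hc : c + r = M) (y : Fin c → Fin M → K)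
    (hy : LinearIndependent K y) :
    ∃ (w : Fin r → Fin M → K) (a : Fin M → Fin c → K) (b : Fin M → Fin r → K),
      ∀ t, (X t : MvPolynomial (Fin M) K) = ∑ l, C (a t l) * (∑ u, C (y l u) * X u) +
        ∑ s, C (b t s) * (∑ u, C (w s u) * X u) := by
  classical
  obtain ⟨W, hW⟩ := Submodule.exists_isCompl (Submodule.span K (Set.range y))
  have h1 := Submodule.finrank_add_eq_of_isCompl hW
  rw [finrank_span_eq_card hy, Module.finrank_fin_fun, Fintype.card_fin] at h1
  have h2 : Module.finrank K W = r := by omega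
  let bW := Module.finBasisOfFinrankEq K W h2
  have h3 : ∀ t : Fin M, ∃ (a : Fin c → K) (b : Fin r → K), (Pi.single t 1 : Fin M → K) =
      ∑ l, a l • y l + ∑ s, b s • (bW s : Fin M → K) := by
    intro t
    have : (Pi.single t 1 : Fin M → K) ∈ Submodule.span K (Set.range y) ⊔ W := by
      rw [hW.sup_eq_top]; trivial
    obtain ⟨p, hp, q, hq, hpq⟩ := Submodule.mem_sup.mp this
    obtain ⟨a, ha⟩ := (Submodule.mem_span_range_iff_exists_fun K).mp hp
    refine ⟨a, bW.repr ⟨q, hq⟩, ?_⟩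
    rw [ha, ← hpq]
    congr 1
    have := congrArg (Subtype.val) (bW.sum_repr ⟨q, hq⟩)
    rw [Submodule.coe_sum] at this
    exact this.symm
  choose a b hab using h3
  refine ⟨fun s => bW s, a, b, fun t => ?_⟩
  have h4 : (X t : MvPolynomial (Fin M) K) = ∑ u, C ((Pi.single t 1 : Fin M → K) u) * X u := by
    simp [Pi.single_apply]
  rw [h4, hab t]
  simp only [Pi.add_apply, Finset.sum_apply, Pi.smul_apply, smul_eq_mul, map_add, map_sum, map_mul,
    add_mul, Finset.sum_add_distrib, Finset.sum_mul, Finset.mul_sum]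
  congr 1
  · rw [Finset.sum_comm]
    simp only [mul_assoc]
  · rw [Finset.sum_comm]
    simp only [mul_assoc]

theorem aux_block_van {M m r c : ℕ} (F Ω : Type) [Field F] [Field Ω] [Algebra ℂ F]
    [Algebra (MvPolynomial (Fin c) ℂ) F] [IsScalarTower ℂ (MvPolynomial (Fin c) ℂ) F]
    [IsFractionRing (MvPolynomial (Fin c) ℂ) F]
    (P : Ideal (MvPolynomial (Fin M) ℂ)) (cl : MvPolynomial (Fin M) ℂ →+* Ω)
    (hcl : ∀ p, cl p = 0 ↔ p ∈ P)
    (g : MvPolynomial (Fin c) ℂ →+* Ω) (hg : Function.Injective g)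
    (y : Fin c → Fin M → ℂ) (w : Fin r → Fin M → ℂ) (a : Fin M → Fin c → ℂ) (b : Fin M → Fin r → ℂ)
    (hgC : ∀ z, g (C z) = cl (C z)) (hgX : ∀ l, g (X l) = cl (∑ t, C (y l t) * X t))
    (hab : ∀ t, (X t : MvPolynomial (Fin M) ℂ) = ∑ l, C (a t l) * (∑ u, C (y l u) * X u) +
        ∑ s, C (b t s) * (∑ u, C (w s u) * X u))
    (x : Fin M → MvPolynomial (Fin r) F)
    (hx : ∀ t, x t = C (algebraMap (MvPolynomial (Fin c) ℂ) _ (∑ l, C (a t l) * X l)) +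
      ∑ s, C (algebraMap (MvPolynomial (Fin c) ℂ) _ (C (b t s))) * X s)
    (f : Fin m → MvPolynomial (Fin M) ℂ) (Λ : Option (Fin r) × Fin m → ℂ)
    (hΛ : ∀ s, ∑ j, C (Λ (s, j)) * f j ∈ P) (j1 : Fin m) (hj1 : f j1 ∉ P)
    (HF : MvPolynomial (Option (Fin r) × Fin m) F)
    (hHF : ∀ [Algebra F Ω] (z0 : Fin r → Ω)
        (Λ0 : Option (Fin r) × Fin m → Ω) (j1 : Fin m),
        (∀ s, ∑ j, Λ0 (s, j) * aeval z0 (aeval x (f j)) = 0) → aeval z0 (aeval x (f j1)) ≠ 0 →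
          aeval Λ0 HF = 0) :
    eval (fun v => algebraMap ℂ F (Λ v)) HF = 0 := by
  let gF : F →+* Ω :=
    IsFractionRing.lift hg
  have hgF : ∀ p, gF (algebraMap _ _ p) = g p := fun p => IsFractionRing.lift_algebraMap hg p
  let _ : Algebra (F) (Ω) :=
    gF.toAlgebra
  have halg : ∀ q, algebraMap (F)
    (Ω) q = gF q := fun q => rfl
  have hCF : ∀ z : ℂ, algebraMap ℂ (F) z =
      algebraMap (MvPolynomial (Fin c) ℂ) _ (C z) := fun z => by
    rw [IsScalarTower.algebraMap_apply ℂ (MvPolynomial (Fin c) ℂ), algebraMap_eq]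
  let z0 : Fin r → Ω := fun s => cl (∑ u, C (w s u) * X u)
  have hcomp : ∀ p, aeval z0 (aeval x p) = cl p := by
    intro p
    induction p using MvPolynomial.induction_on with
    | C z =>
      rw [aeval_C, IsScalarTower.algebraMap_apply ℂ (F) (MvPolynomial _ _),
        algebraMap_eq, aeval_C, hCF, halg, hgF, hgC]
    | add p q hp hq => simp only [map_add, hp, hq]
    | mul_X p t hp =>
      simp only [map_mul, hp]
      congr 1
      rw [aeval_X]
      conv_rhs => rw [hab t]
      simp only [hx, map_add, map_sum, map_mul, aeval_C, aeval_X, halg, hgF, hgC, z0]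
      congr 1
      refine Finset.sum_congr rfl fun l _ => ?_
      congr 1
      rw [hgX, map_sum]
      simp only [map_mul]
  have key := hHF z0
    (fun v => cl (C (Λ v))) j1 (fun s => by
      simp only [hcomp, ← map_mul, ← map_sum]
      rw [hcl]
      exact hΛ s) (by
      rw [hcomp, Ne, hcl]
      exact hj1)
  have h5 : aeval (fun v => cl (C (Λ v))) HF = gF (eval (fun v => algebraMap ℂ _ (Λ v)) HF) := by
    rw [aeval_def, eval, coe_eval₂Hom, eval₂_comp_left gF]
    have : (gF ∘ fun v => algebraMap ℂ F (Λ v)) = fun v => cl (C (Λ v)) := by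
      ext v
      simp only [Function.comp_apply]
      rw [hCF, hgF, hgC]
    rw [this]
    rfl
  rw [h5] at key
  exact (map_eq_zero gF).mp key

theorem aux_finite_block {M m r d : ℕ} (hd : 1 ≤ d) (hr : r ≤ M)
    (f : Fin m → MvPolynomial (Fin M) ℂ) (hf : ∀ j, (f j).totalDegree ≤ d)
    {ι : Type} [Finite ι] (P : ι → Ideal (MvPolynomial (Fin M) ℂ)) (hP : ∀ i, (P i).IsPrime)
    (hh : ∀ i, (P i).height ≤ (r : ℕ∞)) (Λ : ι → Option (Fin r) × Fin m → ℂ)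
    (hΛ : ∀ i s, ∑ j, C (Λ i (s, j)) * f j ∈ P i) (j1 : ι → Fin m) (hj1 : ∀ i, f (j1 i) ∉ P i) :
    ∃ H : MvPolynomial (Option (Fin r) × Fin m) ℂ, H ≠ 0 ∧
      H.totalDegree ≤ (r + 1) * d ^ r ∧ ∀ i, eval (Λ i) H = 0 := by
  classical
  obtain ⟨c, hc⟩ : ∃ c, c + r = M := ⟨M - r, by omega⟩
  rcases isEmpty_or_nonempty ι with hι | ⟨⟨i0⟩⟩
  · exact ⟨1, one_ne_zero, by simp, fun i => (hι.false i).elim⟩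
  obtain ⟨y, hy⟩ := aux_linear_forms P hP c r hc.le hh
  have hyl : LinearIndependent ℂ y := by
    have h1 := (hy i0).linearIndependent
    let L : (Fin M → ℂ) →ₗ[ℂ] MvPolynomial (Fin M) ℂ ⧸ P i0 :=
      { toFun := fun v => Ideal.Quotient.mkₐ ℂ (P i0) (∑ t, C (v t) * X t)
        map_add' := fun u v => by
          simp only [Pi.add_apply, map_add, add_mul, Finset.sum_add_distrib]
        map_smul' := fun a v => by
          simp only [Pi.smul_apply, smul_eq_mul, C_mul, mul_assoc, ← Finset.mul_sum,
            RingHom.id_apply]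
          rw [← smul_eq_C_mul, map_smul] }
    exact LinearIndependent.of_comp L h1
  obtain ⟨w, a, b, hab⟩ := aux_complete hc y hyl
  let x : Fin M → MvPolynomial (Fin r) (FractionRing (MvPolynomial (Fin c) ℂ)) := fun t =>
    C (algebraMap (MvPolynomial (Fin c) ℂ) _ (∑ l, C (a t l) * X l)) +
      ∑ s, C (algebraMap (MvPolynomial (Fin c) ℂ) _ (C (b t s))) * X s
  have hx : ∀ t, (x t).totalDegree ≤ 1 := by
    intro t
    refine (totalDegree_add _ _).trans (max_le (by rw [totalDegree_C]; exact Nat.zero_le _) ?_)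
    refine totalDegree_finsetSum_le fun s _ => (totalDegree_mul _ _).trans ?_
    simp
  obtain ⟨HF, hHF0, hHFd, hHF⟩ := aux_L4 hd (fun j => aeval x (f j))
    (fun j => (aux_subst_deg x hx (f j)).trans (hf j))
  obtain ⟨H, hH0, hHd, hH⟩ := aux_functional (K := ℂ) HF hHF0
  refine ⟨H, hH0, hHd.trans hHFd, fun i => hH _ ?_⟩
  have := hP i
  let cl : MvPolynomial (Fin M) ℂ →+* FractionRing (MvPolynomial (Fin M) ℂ ⧸ P i) :=
    (algebraMap _ _).comp (Ideal.Quotient.mk (P i))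
  have hcl : ∀ p, cl p = 0 ↔ p ∈ P i := by
    intro p
    rw [← Ideal.Quotient.eq_zero_iff_mem, ← map_eq_zero_iff (algebraMap (MvPolynomial (Fin M) ℂ ⧸ P i)
      (FractionRing (MvPolynomial (Fin M) ℂ ⧸ P i))) (IsFractionRing.injective _ _)]
    rfl
  let g0 : MvPolynomial (Fin c) ℂ →ₐ[ℂ] MvPolynomial (Fin M) ℂ := aeval (fun l => ∑ t, C (y l t) * X t)
  let g : MvPolynomial (Fin c) ℂ →+* FractionRing (MvPolynomial (Fin M) ℂ ⧸ P i) :=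
    cl.comp g0.toRingHom
  have hg : Function.Injective g := by
    have h1 := hy i
    rw [algebraicIndependent_iff_injective_aeval] at h1
    have h2 : ∀ p, g p = algebraMap _ _ (aeval (fun l => Ideal.Quotient.mkₐ ℂ (P i) (∑ t, C (y l t) * X t)) p) := by
      intro p
      have : aeval (fun l => Ideal.Quotient.mkₐ ℂ (P i) (∑ t, C (y l t) * X t)) =
        (Ideal.Quotient.mkₐ ℂ (P i)).comp g0 := by
        refine algHom_ext fun l => ?_
        rw [aeval_X, AlgHom.comp_apply, aeval_X]
      rw [this]
      rfl
    intro p q hpq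
    rw [h2, h2] at hpq
    exact h1 (IsFractionRing.injective _ _ hpq)
  exact aux_block_van (FractionRing (MvPolynomial (Fin c) ℂ)) (FractionRing (MvPolynomial (Fin M) ℂ ⧸ P i))
    (P i) cl hcl g hg y w a b (fun z => by simp [g, g0]) (fun l => by simp only [g, RingHom.comp_apply]; exact congrArg cl (aeval_X _ l))
    hab x (fun t => rfl) f (Λ i) (hΛ i) (j1 i) (hj1 i) HF (fun z0 Λ0 j1 h1 h2 => hHF _ z0 Λ0 j1 h1 h2)

theorem aux_block {M m r d : ℕ} (hd : 1 ≤ d) (hr : r ≤ M)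
    (f : Fin m → MvPolynomial (Fin M) ℂ) (hf : ∀ j, (f j).totalDegree ≤ d) :
    ∃ H : MvPolynomial (Fin (r + 1) × Fin m) ℂ, H ≠ 0 ∧
      H.totalDegree ≤ (r + 1) * d ^ r ∧ ∀ Λ : Fin (r + 1) → Fin m → ℂ,
        eval (fun p => Λ p.1 p.2) H ≠ 0 → ∀ P : Ideal (MvPolynomial (Fin M) ℂ), P.IsPrime →
          (∀ s, ∑ j, Λ s j • f j ∈ P) → (∃ j, f j ∉ P) → ¬ P.height ≤ (r : ℕ∞) := by
  classical
  let B : Set (Option (Fin r) × Fin m → ℂ) := {Λ | ∃ P : Ideal (MvPolynomial (Fin M) ℂ), P.IsPrime ∧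
    (∀ s, ∑ j, C (Λ (s, j)) * f j ∈ P) ∧ (∃ j, f j ∉ P) ∧ P.height ≤ (r : ℕ∞)}
  obtain ⟨H, hH0, hHd, hH⟩ := aux_finite_red ((r + 1) * d ^ r) B (by
    intro B0 hB0
    have hB : ∀ b : B0, ∃ P : Ideal (MvPolynomial (Fin M) ℂ), P.IsPrime ∧
      (∀ s, ∑ j, C (b.1 (s, j)) * f j ∈ P) ∧ (∃ j, f j ∉ P) ∧ P.height ≤ (r : ℕ∞) :=
      fun b => hB0 b.2
    choose P hP hΛ hj1 hh using hB
    choose j1 hj1 using hj1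
    obtain ⟨H, h0, h1, h2⟩ := aux_finite_block hd hr f hf P hP hh (fun b => b.1) hΛ j1 hj1
    exact ⟨H, h0, h1, fun b hb => h2 ⟨b, hb⟩⟩)
  let e := _root_.finSuccEquiv r
  have he : Function.Injective (Prod.map e.symm (id : Fin m → Fin m)) :=
    Function.Injective.prodMap e.symm.injective Function.injective_id
  refine ⟨rename (Prod.map e.symm id) H, ?_, (totalDegree_rename_le _ _).trans hHd, ?_⟩
  · intro h
    exact hH0 (rename_injective _ he (by rw [h, map_zero]))
  · intro Λ hΛ P hP hg hj hh
    apply hΛ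
    rw [eval_rename]
    refine hH _ ⟨P, hP, fun s => ?_, hj, hh⟩
    have := hg (e.symm s)
    simp only [smul_eq_C_mul] at this
    exact this

theorem generic_linear_combinations_tuple (n m k d N : ℕ)
    (hn : 1 ≤ n) (hm : 1 ≤ m) (hk1 : 1 ≤ k) (hkn : k ≤ n) (hd : 1 ≤ d)
    (hN : N = (m + k - 1) / k)
    (f : Fin m → MvPolynomial (Fin (n + 1)) ℂ)
    (hf : ∀ j : Fin m, (f j).IsHomogeneous d) :
    ∃ H : MvPolynomial (Fin N × Fin k × Fin m) ℂ, H ≠ 0 ∧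
      H.totalDegree ≤ N * k * d ^ (k - 1) + m ∧
      ∀ Λ : Fin N → Fin k → Fin m → ℂ,
        MvPolynomial.eval (fun p : Fin N × Fin k × Fin m => Λ p.1 p.2.1 p.2.2) H ≠ 0 →
        ((∀ i : Fin N,
          ∀ p ∈ (Ideal.span
              (Set.range fun s : Fin k => ∑ j : Fin m, Λ i s j • f j)).minimalPrimes,
            p ∈ (Ideal.span (Set.range f)).minimalPrimes ∨
            ∃ hp : p.IsPrime,
              Order.height (⟨p, hp⟩ :
                PrimeSpectrum (MvPolynomial (Fin (n + 1)) ℂ)) = (k : ℕ∞)) ∧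
        Ideal.span
            (Set.range fun q : Fin N × Fin k =>
              ∑ j : Fin m, Λ q.1 q.2 j • f j) =
          Ideal.span (Set.range f)) := by
  classical
  obtain ⟨r, rfl⟩ : ∃ r, k = r + 1 := ⟨k - 1, by omega⟩
  have hmN : m ≤ N * (r + 1) := by
    have h1 := Nat.lt_div_mul_add (a := m + (r + 1) - 1) (Nat.succ_pos r)
    rw [hN]
    simp only [Nat.succ_eq_add_one] at h1
    omega
  obtain ⟨Hb, hHb0, hHbd, hHb⟩ := aux_block (M := n + 1) (r := r) hd (by omega) f
    (fun j => (hf j).totalDegree_le)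
  let ι : Fin m → Fin N × Fin (r + 1) := fun j => finProdFinEquiv.symm (Fin.castLE hmN j)
  have hι : Function.Injective ι :=
    finProdFinEquiv.symm.injective.comp (Fin.castLE_injective hmN)
  let A : Matrix (Fin m) (Fin m) (MvPolynomial (Fin N × Fin (r + 1) × Fin m) ℂ) :=
    Matrix.of fun j j' => X ((ι j).1, (ι j).2, j')
  have hAdet : ∀ Λ : Fin N → Fin (r + 1) → Fin m → ℂ,
      eval (fun p : Fin N × Fin (r + 1) × Fin m => Λ p.1 p.2.1 p.2.2) A.det =
        (Matrix.of fun j j' => Λ (ι j).1 (ι j).2 j').det := by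
    intro Λ
    rw [RingHom.map_det]
    congr 1
    ext j j'
    simp [A]
  have hA0 : A.det ≠ 0 := by
    intro h
    have h1 := hAdet (fun i s j' => if (i, s) = ι j' then 1 else 0)
    rw [h, map_zero] at h1
    have h2 : (Matrix.of fun j j' => if ((ι j).1, (ι j).2) = ι j' then (1 : ℂ) else 0) = 1 := by
      ext j j'
      simp [Matrix.one_apply, hι.eq_iff]
    rw [h2, Matrix.det_one] at h1
    exact zero_ne_one h1
  have hAd : A.det.totalDegree ≤ m := by
    have := (aux_det_hom A (fun a b => isHomogeneous_X _ _)).totalDegree_le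
    simpa using this
  have hri : ∀ i : Fin N, Function.Injective (fun v : Fin (r + 1) × Fin m => (i, v)) :=
    fun i => Prod.mk_right_injective i
  refine ⟨(∏ i : Fin N, rename (fun v : Fin (r + 1) × Fin m => (i, v)) Hb) * A.det, ?_, ?_, ?_⟩
  · refine mul_ne_zero (Finset.prod_ne_zero_iff.mpr fun i _ h => ?_) hA0
    exact hHb0 (rename_injective _ (hri i) (by rw [h, map_zero]))
  · refine (totalDegree_mul _ _).trans (Nat.add_le_add ?_ hAd)
    refine (totalDegree_finsetProd _ _).trans ?_
    refine (Finset.sum_le_sum fun i _ => (totalDegree_rename_le _ _).trans hHbd).trans ?_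
    simp [mul_assoc]
  intro Λ hΛ
  rw [map_mul, map_prod] at hΛ
  have hprod := left_ne_zero_of_mul hΛ
  have hdet := right_ne_zero_of_mul hΛ
  rw [hAdet] at hdet
  rw [Finset.prod_ne_zero_iff] at hprod
  constructor
  · intro i p hp
    have hpp : p.IsPrime := hp.1.1
    have hgp : ∀ s, ∑ j, Λ i s j • f j ∈ p := fun s =>
      hp.1.2 (Ideal.subset_span ⟨s, rfl⟩)
    by_cases hall : ∀ j, f j ∈ p
    · left
      refine ⟨⟨hpp, ?_⟩, ?_⟩
      · rw [Ideal.span_le]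
        rintro _ ⟨j, rfl⟩
        exact hall j
      · rintro q ⟨hq, hfq⟩ hqp
        refine hp.2 ⟨hq, ?_⟩ hqp
        rw [Ideal.span_le]
        rintro _ ⟨s, rfl⟩
        refine Ideal.sum_mem _ fun j _ => ?_
        rw [smul_eq_C_mul]
        exact Ideal.mul_mem_left _ _ (hfq (Ideal.subset_span ⟨j, rfl⟩))
    · right
      push Not at hall
      refine ⟨hpp, ?_⟩
      rw [← PrimeSpectrum.height_eq_orderHeight]
      change p.height = _
      have h1 := hprod i (Finset.mem_univ i)
      rw [eval_rename] at h1
      have h2 := hHb (Λ i) h1 p hpp hgp hall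
      have h3 := Ideal.height_le_card_of_mem_minimalPrimes_span (Set.finite_range _) hp
      have h4 : p.height ≤ ((r + 1 : ℕ) : ℕ∞) := by
        refine h3.trans ?_
        rw [Nat.cast_le]
        have := Set.ncard_image_le (s := Set.univ) (f := fun s => ∑ j, Λ i s j • f j) Set.finite_univ
        rw [Set.image_univ, Set.ncard_univ, Nat.card_eq_fintype_card, Fintype.card_fin] at this
        exact this
      refine le_antisymm h4 ?_
      rw [not_le] at h2
      have := Order.add_one_le_of_lt h2
      simpa using this
  · apply le_antisymm
    · rw [Ideal.span_le]
      rintro _ ⟨q, rfl⟩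
      refine Ideal.sum_mem _ fun j _ => ?_
      rw [smul_eq_C_mul]
      exact Ideal.mul_mem_left _ _ (Ideal.subset_span ⟨j, rfl⟩)
    · rw [Ideal.span_le]
      rintro _ ⟨j, rfl⟩
      set A' : Matrix (Fin m) (Fin m) ℂ := Matrix.of fun j j' => Λ (ι j).1 (ι j).2 j' with hA'
      have h1 := Matrix.nonsing_inv_mul A' (isUnit_iff_ne_zero.mpr hdet)
      have h2 : f j = ∑ l, A'⁻¹ j l • ∑ j', Λ (ι l).1 (ι l).2 j' • f j' := by
        simp only [Finset.smul_sum, smul_smul]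
        rw [Finset.sum_comm]
        simp only [← Finset.sum_smul]
        have h3 : ∀ j', ∑ l, A'⁻¹ j l * Λ (ι l).1 (ι l).2 j' = (1 : Matrix (Fin m) (Fin m) ℂ) j j' := by
          intro j'
          rw [← h1, Matrix.mul_apply]
          rfl
        simp [h3, Matrix.one_apply]
      rw [h2]
      refine Ideal.sum_mem _ fun l _ => ?_
      rw [smul_eq_C_mul]
      exact Ideal.mul_mem_left _ _ (Ideal.subset_span ⟨ι l, rfl⟩)
end
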